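/- arXiv:q-alg/9708008 — 3 statements merged into one kernel-verified Lean document; each statement's English description precedes it below -/
import Mathlib

section
/- Let F be the fermionic Fock space of the bc-system and let L_m, W̃_m (m ∈ ℤ) be the modes of the Virasoro field T(z) = :∂b(z)c(z): and the weight-3 field W̃(z) = (1/2)(:∂²b(z)c(z): − :∂b(z)∂c(z):), as defined in the context. For every l ∈ ℤ, the subspace F̄^l = {x ∈ F^l : c(0)x = 0} satisfies L_m(F̄^l) ⊆ F̄^l and W̃_m(F̄^l) ⊆ F̄^l for all m ∈ ℤ, and moreover every nonzero linear subspace U ⊆ F̄^l with L_m(U) ⊆ U and W̃_m(U) ⊆ U for all m ∈ ℤ is equal to F̄^l. (In other words, F̄^l is an irreducible module over the W_3 algebra with central charge −2 realized by these modes.) -/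
noncomputable section

open ExteriorAlgebra

/-- Index type for the basis of `V`: `Sum.inl n` corresponds to `v_n` (`n ≥ 0`),
and `Sum.inr n` corresponds to `w_{n+1}` (so the `w_k` for `k ≥ 1`). -/
abbrev BCIndex : Type := ℕ ⊕ ℕ

/-- The vector space `V` with basis `{v_n : n ≥ 0} ∪ {w_n : n ≥ 1}`. -/
abbrev BCSpace : Type := BCIndex →₀ ℂ

/-- The fermionic Fock space: the exterior algebra of `V`. -/
abbrev FockF : Type := ExteriorAlgebra ℂ BCSpace

/-- The basis vector of `V` with index `i`. -/
def bv (i : BCIndex) : BCSpace := Finsupp.single i 1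

/-- The linear functional sending the basis vector `i` to `1` and all others to `0`. -/
def bvDual (i : BCIndex) : Module.Dual ℂ BCSpace := Finsupp.lapply i

/-- The operator `b(n)`: for `n ≤ 0` left exterior multiplication by `v_{-n}`,
for `n ≥ 1` contraction with the functional dual to `w_n`. -/
def bOp (n : ℤ) : Module.End ℂ FockF :=
  if n ≤ 0 then LinearMap.mulLeft ℂ (ι ℂ (bv (Sum.inl (-n).toNat)))
  else CliffordAlgebra.contractLeft (bvDual (Sum.inr (n - 1).toNat))

/-- The operator `c(n)`: for `n ≥ 0` contraction with the functional dual to `v_n`,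
for `n ≤ -1` left exterior multiplication by `w_{-n}`. -/
def cOp (n : ℤ) : Module.End ℂ FockF :=
  if 0 ≤ n then CliffordAlgebra.contractLeft (bvDual (Sum.inl n.toNat))
  else LinearMap.mulLeft ℂ (ι ℂ (bv (Sum.inr (-n - 1).toNat)))

/-- The normally ordered product `:b(k)c(j):`. -/
def nbc (k j : ℤ) : Module.End ℂ FockF :=
  if 1 ≤ k ∧ j ≤ -1 then -(cOp j ∘ₗ bOp k) else bOp k ∘ₗ cOp j

/-- The Virasoro modes `L_m` of `T(z) = :∂b(z)c(z):`,
`L_m x = Σ_k (−k)·:b(k)c(m−k):·x` (a finite sum on each `x`). -/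
def Lmode (m : ℤ) (x : FockF) : FockF :=
  ∑ᶠ k : ℤ, (-k : ℂ) • nbc k (m - k) x

/-- The modes `W̃_m` of `W̃(z) = (1/2)(:∂²b(z)c(z): − :∂b(z)∂c(z):)`,
`W̃_m x = (1/2)Σ_k k(2k−m)·:b(k)c(m−k):·x` (a finite sum on each `x`). -/
def Wmode (m : ℤ) (x : FockF) : FockF :=
  ∑ᶠ k : ℤ, ((1 / 2 : ℂ) * k * (2 * k - m)) • nbc k (m - k) x

/-- The charge of a list of basis indices: (number of `v`-type) − (number of `w`-type). -/
def chargeOf (L : List BCIndex) : ℤ :=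
  (L.countP Sum.isLeft : ℤ) - (L.countP Sum.isRight : ℤ)

/-- `F^l`: the span of the wedge monomials of charge `l`. -/
def FF (l : ℤ) : Submodule ℂ FockF :=
  Submodule.span ℂ
    {x | ∃ L : List BCIndex, chargeOf L = l ∧ x = (L.map fun i => ι ℂ (bv i)).prod}

/-- `F̄^l = {x ∈ F^l : c(0)x = 0}`. -/
def FFbar (l : ℤ) : Submodule ℂ FockF := FF l ⊓ LinearMap.ker (cOp 0)

/-- Creation operator: left exterior multiplication by the basis vector `i`. -/
def cre (i : BCIndex) : Module.End ℂ FockF := LinearMap.mulLeft ℂ (ι ℂ (bv i))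

/-- Annihilation operator: contraction with the functional dual to the basis vector `i`. -/
def ann (i : BCIndex) : Module.End ℂ FockF := CliffordAlgebra.contractLeft (bvDual i)

lemma bvDual_bv (i j : BCIndex) : bvDual i (bv j) = if i = j then 1 else 0 := by
  simp [bvDual, bv, Finsupp.single_apply, eq_comm]

lemma cre_cre (i j : BCIndex) (x : FockF) : cre i (cre j x) = -cre j (cre i x) := by
  have h := ExteriorAlgebra.ι_add_mul_swap (R := ℂ) (bv i) (bv j)
  simp only [cre, LinearMap.mulLeft_apply, ← mul_assoc, eq_neg_iff_add_eq_zero, ← add_mul, h,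
    zero_mul]

lemma cre_self (i : BCIndex) (x : FockF) : cre i (cre i x) = 0 := by
  simp [cre, LinearMap.mulLeft_apply, ← mul_assoc]

lemma ann_ann (i j : BCIndex) (x : FockF) : ann i (ann j x) = -ann j (ann i x) :=
  CliffordAlgebra.contractLeft_comm _ _ _

lemma ann_cre (i j : BCIndex) (x : FockF) :
    ann i (cre j x) = (if i = j then x else 0) - cre j (ann i x) := by
  have h := CliffordAlgebra.contractLeft_ι_mul (Q := (0 : QuadraticForm ℂ BCSpace))
    (d := bvDual i) (bv j) x
  rw [bvDual_bv, ite_smul, one_smul, zero_smul] at h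
  exact h

/-- The operator at the mode `i` which raises the charge by one. -/
def up : BCIndex → Module.End ℂ FockF
  | Sum.inl n => cre (Sum.inl n)
  | Sum.inr n => ann (Sum.inr n)

/-- The operator at the mode `i` which lowers the charge by one. -/
def down : BCIndex → Module.End ℂ FockF
  | Sum.inl n => ann (Sum.inl n)
  | Sum.inr n => cre (Sum.inr n)

lemma up_up (i j : BCIndex) (x : FockF) : up i (up j x) = -up j (up i x) := by
  rcases i with i | i <;> rcases j with j | j <;> simp only [up]
  · exact cre_cre _ _ _
  · simp [ann_cre]
  · simp [ann_cre]
  · exact ann_ann _ _ _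

lemma down_down (i j : BCIndex) (x : FockF) : down i (down j x) = -down j (down i x) := by
  rcases i with i | i <;> rcases j with j | j <;> simp only [down]
  · exact ann_ann _ _ _
  · simp [ann_cre]
  · simp [ann_cre]
  · exact cre_cre _ _ _

lemma up_down (i j : BCIndex) (x : FockF) :
    up i (down j x) = (if i = j then x else 0) - down j (up i x) := by
  rcases i with i | i <;> rcases j with j | j <;> simp only [up, down]
  · rw [ann_cre]
    simp [eq_comm]
  · simpa using cre_cre _ _ _
  · simpa using ann_ann _ _ _
  · exact ann_cre _ _ _

/-- The basis index of the conjugate pair `b(k)`, `c(-k)`. -/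
def modeIdx (k : ℤ) : BCIndex :=
  if k ≤ 0 then Sum.inl (-k).toNat else Sum.inr (k - 1).toNat

lemma modeIdx_injective : Function.Injective modeIdx := by
  intro k j h
  unfold modeIdx at h
  split_ifs at h <;> simp at h <;> omega

lemma modeIdx_surjective : Function.Surjective modeIdx := by
  rintro (n | n)
  · exact ⟨-n, by simp [modeIdx]⟩
  · exact ⟨n + 1, by rw [modeIdx, if_neg (by omega)]; simp⟩

lemma modeIdx_zero : modeIdx 0 = Sum.inl 0 := by simp [modeIdx]

lemma bOp_eq_up (k : ℤ) : bOp k = up (modeIdx k) := by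
  unfold bOp modeIdx
  split_ifs <;> rfl

lemma cOp_neg_eq_down (k : ℤ) : cOp (-k) = down (modeIdx k) := by
  unfold cOp modeIdx
  by_cases h : k ≤ 0
  · rw [if_pos h, if_pos (by omega)]; rfl
  · rw [if_neg h, if_neg (by omega), neg_neg]; rfl

lemma cOp_eq_down (k : ℤ) : cOp k = down (modeIdx (-k)) := by
  rw [← cOp_neg_eq_down, neg_neg]

lemma bOp_bOp (m n : ℤ) (x : FockF) : bOp m (bOp n x) = -bOp n (bOp m x) := by
  simp only [bOp_eq_up]; exact up_up _ _ _

lemma cOp_cOp (m n : ℤ) (x : FockF) : cOp m (cOp n x) = -cOp n (cOp m x) := by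
  simp only [cOp_eq_down]; exact down_down _ _ _

lemma bOp_cOp (m n : ℤ) (x : FockF) :
    bOp m (cOp n x) = (if m = -n then x else 0) - cOp n (bOp m x) := by
  simp only [bOp_eq_up, cOp_eq_down, up_down, modeIdx_injective.eq_iff]

lemma cOp_bOp (m n : ℤ) (x : FockF) :
    cOp n (bOp m x) = (if m = -n then x else 0) - bOp m (cOp n x) := by
  rw [bOp_cOp]; abel

lemma bOp_self (m : ℤ) (x : FockF) : bOp m (bOp m x) = 0 := by
  simpa [eq_neg_iff_add_eq_zero, ← two_smul ℂ] using bOp_bOp m m x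

lemma cOp_self (m : ℤ) (x : FockF) : cOp m (cOp m x) = 0 := by
  simpa [eq_neg_iff_add_eq_zero, ← two_smul ℂ] using cOp_cOp m m x

lemma nbc_apply_of_add_ne_zero {k j : ℤ} (h : k + j ≠ 0) (x : FockF) :
    nbc k j x = bOp k (cOp j x) := by
  unfold nbc
  split_ifs
  · simp [bOp_cOp, show k ≠ -j by omega]
  · rfl

lemma nbc_bOp (k j : ℤ) (x : FockF) :
    nbc k (-k) (bOp j x) - bOp j (nbc k (-k) x) = if k = j then bOp j x else 0 := by
  by_cases hkj : k = j <;> unfold nbc <;> split_ifs <;>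
    simp [bOp_bOp k j, cOp_bOp, bOp_self, hkj, eq_comm (a := j)]

lemma nbc_cOp (k j : ℤ) (x : FockF) :
    nbc k (-k) (cOp j x) - cOp j (nbc k (-k) x) = if k = -j then -cOp j x else 0 := by
  by_cases hkj : k = -j <;> unfold nbc <;> split_ifs <;>
    simp [cOp_cOp (-k) j, bOp_cOp, cOp_self, hkj]

lemma finite_ann_ne_zero (x : FockF) : {i | ann i x ≠ 0}.Finite := by
  induction x using CliffordAlgebra.left_induction with
  | algebraMap r => simp [ann, CliffordAlgebra.contractLeft_algebraMap]
  | add x y hx hy =>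
    refine (hx.union hy).subset fun i hi => ?_
    by_contra h
    simp only [Set.mem_union, Set.mem_ofPred_eq, not_or, not_not] at h
    exact hi (by rw [map_add, h.1, h.2, add_zero])
  | ι_mul x v hx =>
    refine (hx.union v.support.finite_toSet).subset fun i hi => ?_
    by_contra h
    simp only [Set.mem_union, Set.mem_ofPred_eq, not_or, not_not, Finset.mem_coe,
      Finsupp.mem_support_iff] at h
    refine hi ?_
    have h' := CliffordAlgebra.contractLeft_ι_mul (Q := (0 : QuadraticForm ℂ BCSpace))
      (d := bvDual i) v x
    have h1 : CliffordAlgebra.contractLeft (bvDual i) x = 0 := h.1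
    rw [h1, mul_zero, sub_zero, show bvDual i v = 0 from h.2, zero_smul] at h'
    exact h'

lemma exists_bound (x : FockF) :
    ∃ N : ℤ, 0 ≤ N ∧ ∀ n, N < n → bOp n x = 0 ∧ cOp n x = 0 := by
  have h := finite_ann_ne_zero x
  have hb : (modeIdx ⁻¹' {i | ann i x ≠ 0}).Finite := h.preimage modeIdx_injective.injOn
  obtain ⟨B, hB⟩ := hb.bddAbove
  obtain ⟨C, hC⟩ := hb.bddBelow
  refine ⟨max 0 (max B (-C)), by simp, fun n hn => ⟨?_, ?_⟩⟩
  · by_contra hne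
    have : n ≤ B := hB (by
      rw [bOp_eq_up] at hne
      simp only [modeIdx, if_neg (show ¬ n ≤ 0 by omega), Set.mem_preimage, Set.mem_ofPred_eq,
        up] at hne ⊢
      exact hne)
    omega
  · by_contra hne
    have : C ≤ -n := hC (by
      rw [cOp_eq_down] at hne
      simp only [modeIdx, if_pos (show -n ≤ 0 by omega), Set.mem_preimage, Set.mem_ofPred_eq,
        down] at hne ⊢
      exact hne)
    omega

lemma finite_nbc_ne_zero (m : ℤ) (x : FockF) : {k | nbc k (m - k) x ≠ 0}.Finite := by
  obtain ⟨N, hN0, hN⟩ := exists_bound x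
  refine (Set.finite_Icc (min 0 (m - N)) (max N m)).subset fun k hk => ?_
  by_contra h
  rw [Set.mem_Icc, not_and_or, not_le, not_le] at h
  refine hk ?_
  rcases h with h | h
  · rw [nbc, if_neg (by omega)]
    simp [(hN (m - k) (by omega)).2]
  · rw [nbc, if_pos (by omega)]
    simp [(hN k (by omega)).1]

lemma finite_support_smul_nbc (f : ℤ → ℂ) (m : ℤ) (x : FockF) :
    (Function.support fun k => f k • nbc k (m - k) x).Finite :=
  (finite_nbc_ne_zero m x).subset fun k hk h => hk (by simp [h])

/-- The operator `Σ_k f(k) :b(k)c(m-k):`. -/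
def modeOp (f : ℤ → ℂ) (m : ℤ) : Module.End ℂ FockF where
  toFun x := ∑ᶠ k : ℤ, f k • nbc k (m - k) x
  map_add' x y := by
    rw [← finsum_add_distrib (finite_support_smul_nbc f m x) (finite_support_smul_nbc f m y)]
    simp
  map_smul' r x := by
    rw [RingHom.id_apply, smul_finsum' _ (finite_support_smul_nbc f m x)]
    simp [smul_comm r]

lemma modeOp_apply (f : ℤ → ℂ) (m : ℤ) (x : FockF) :
    modeOp f m x = ∑ᶠ k : ℤ, f k • nbc k (m - k) x := rfl

lemma modeOp_add_smul (f g : ℤ → ℂ) (r s : ℂ) (m : ℤ) (x : FockF) :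
    modeOp (fun k => r * f k + s * g k) m x = r • modeOp f m x + s • modeOp g m x := by
  simp only [modeOp_apply]
  rw [smul_finsum' _ (finite_support_smul_nbc f m x),
    smul_finsum' _ (finite_support_smul_nbc g m x), ← finsum_add_distrib]
  · simp [add_smul, mul_smul]
  · simpa [smul_smul, Function.HasFiniteSupport] using
      finite_support_smul_nbc (fun k => r * f k) m x
  · simpa [smul_smul, Function.HasFiniteSupport] using
      finite_support_smul_nbc (fun k => s * g k) m x

lemma modeOp_zero_bOp (g : ℤ → ℂ) (j : ℤ) (x : FockF) :
    modeOp g 0 (bOp j x) = bOp j (modeOp g 0 x) + g j • bOp j x := by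
  rw [← sub_eq_iff_eq_add']
  simp only [modeOp_apply]
  rw [map_finsum _ (finite_support_smul_nbc g 0 x), ← finsum_sub_distrib
    (finite_support_smul_nbc g 0 _), finsum_eq_single _ j]
  · simp only [zero_sub, map_smul, ← smul_sub, nbc_bOp, if_true]
  · intro k hk
    simp only [zero_sub, map_smul, ← smul_sub, nbc_bOp, if_neg hk, smul_zero]
  · exact (finite_support_smul_nbc g 0 x).subset fun k hk h => hk (by dsimp only at h ⊢; rw [h, map_zero])

lemma modeOp_zero_cOp (g : ℤ → ℂ) (j : ℤ) (x : FockF) :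
    modeOp g 0 (cOp j x) = cOp j (modeOp g 0 x) - g (-j) • cOp j x := by
  rw [sub_eq_add_neg, ← sub_eq_iff_eq_add']
  simp only [modeOp_apply]
  rw [map_finsum _ (finite_support_smul_nbc g 0 x), ← finsum_sub_distrib
    (finite_support_smul_nbc g 0 _), finsum_eq_single _ (-j)]
  · simp only [zero_sub, map_smul, ← smul_sub, nbc_cOp, if_true, smul_neg]
  · intro k hk
    simp only [zero_sub, map_smul, ← smul_sub, nbc_cOp, if_neg hk, smul_zero]
  · exact (finite_support_smul_nbc g 0 x).subset fun k hk h => hk (by dsimp only at h ⊢; rw [h, map_zero])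

lemma modeOp_zero_nbc (g : ℤ → ℂ) {k j : ℤ} (h : k + j ≠ 0) (x : FockF) :
    modeOp g 0 (nbc k j x) = nbc k j (modeOp g 0 x) + (g k - g (-j)) • nbc k j x := by
  simp only [nbc_apply_of_add_ne_zero h, modeOp_zero_bOp, modeOp_zero_cOp, map_sub, map_smul,
    sub_smul]
  abel

lemma modeOp_zero_modeOp (g f : ℤ → ℂ) {m : ℤ} (hm : m ≠ 0) (x : FockF) :
    modeOp g 0 (modeOp f m x) - modeOp f m (modeOp g 0 x) =
      modeOp (fun k => f k * (g k - g (k - m))) m x := by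
  rw [modeOp_apply f m x, modeOp_apply f m (modeOp g 0 x),
    map_finsum _ (finite_support_smul_nbc f m x),
    ← finsum_sub_distrib _ (finite_support_smul_nbc f m _), modeOp_apply _ m]
  · refine finsum_congr fun k => ?_
    rw [map_smul, modeOp_zero_nbc g (by omega), neg_sub, smul_add, add_sub_cancel_left, smul_smul]
  · exact (finite_support_smul_nbc f m x).subset fun k hk h => hk (by simp [h])

section Invariant

variable {U : Submodule ℂ FockF}

lemma modeOp_mul_sub_mem (hW : ∀ x ∈ U, modeOp (fun k => (k : ℂ) ^ 2) 0 x ∈ U) {m : ℤ}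
    (hm : m ≠ 0) {f : ℤ → ℂ} (hf : ∀ x ∈ U, modeOp f m x ∈ U) (a : ℂ) :
    ∀ x ∈ U, modeOp (fun k => f k * (k - a)) m x ∈ U := by
  intro x hx
  have hm' : (m : ℂ) ≠ 0 := by exact_mod_cast hm
  have h := modeOp_zero_modeOp (fun k => (k : ℂ) ^ 2) f hm x
  have hmem := U.sub_mem (hW _ (hf x hx)) (hf _ (hW x hx))
  rw [h] at hmem
  convert U.add_mem (U.smul_mem (1 / (2 * m)) hmem) (U.smul_mem ((m : ℂ) / 2 - a) (hf x hx))
    using 1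
  rw [← modeOp_add_smul]
  congr 2
  funext k
  push_cast
  field_simp
  ring

lemma modeOp_mul_prod_mem (hW : ∀ x ∈ U, modeOp (fun k => (k : ℂ) ^ 2) 0 x ∈ U) {m : ℤ}
    (hm : m ≠ 0) {f : ℤ → ℂ} (hf : ∀ x ∈ U, modeOp f m x ∈ U) (S : Finset ℤ) :
    ∀ x ∈ U, modeOp (fun k => f k * ∏ i ∈ S, ((k : ℂ) - i)) m x ∈ U := by
  induction S using Finset.induction_on with
  | empty => simpa using hf
  | insert a S ha ih =>
    have h := modeOp_mul_sub_mem hW hm ih a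
    simpa only [Finset.prod_insert ha, mul_assoc, mul_comm (_ - (a : ℂ))] using h

lemma bOp_cOp_mem_of_add_ne_zero (hW : ∀ x ∈ U, modeOp (fun k => (k : ℂ) ^ 2) 0 x ∈ U)
    (hL : ∀ m, ∀ x ∈ U, modeOp (fun k => -(k : ℂ)) m x ∈ U) {k j : ℤ} (hk : k ≠ 0)
    (hkj : k + j ≠ 0) {x : FockF} (hx : x ∈ U) : bOp k (cOp j x) ∈ U := by
  obtain ⟨m, rfl⟩ : ∃ m, j = m - k := ⟨k + j, by ring⟩
  rw [add_sub_cancel] at hkj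
  have hS := finite_nbc_ne_zero m x
  have h := modeOp_mul_prod_mem hW hkj (hL m) (hS.toFinset.erase k) x hx
  rw [modeOp_apply, finsum_eq_single _ k, nbc_apply_of_add_ne_zero (by omega)] at h
  · refine (Submodule.smul_mem_iff U ?_).1 h
    refine mul_ne_zero (by simpa using hk) (Finset.prod_ne_zero_iff.2 fun i hi => ?_)
    rw [sub_ne_zero]
    exact_mod_cast (Finset.ne_of_mem_erase hi).symm
  · intro t ht
    by_cases h0 : nbc t (m - t) x = 0
    · rw [h0, smul_zero]
    · have ht' : t ∈ hS.toFinset.erase k := Finset.mem_erase.2 ⟨ht, by simpa using h0⟩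
      rw [Finset.prod_eq_zero ht' (sub_self (t : ℂ)), mul_zero, zero_smul]

lemma bOp_cOp_mem (hW : ∀ x ∈ U, modeOp (fun k => (k : ℂ) ^ 2) 0 x ∈ U)
    (hL : ∀ m, ∀ x ∈ U, modeOp (fun k => -(k : ℂ)) m x ∈ U) {k j : ℤ} (hk : k ≠ 0)
    {x : FockF} (hx : x ∈ U) : bOp k (cOp j x) ∈ U := by
  by_cases hkj : k + j = 0
  · obtain rfl : j = -k := by omega
    obtain ⟨N, hN0, hN⟩ := exists_bound x
    obtain ⟨n, hnN, hnk⟩ : ∃ n, N < n ∧ |k| < n :=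
      ⟨max N |k| + 1, by omega, by omega⟩
    rw [abs_lt] at hnk
    have h := bOp_cOp_mem_of_add_ne_zero hW hL (k := k) (j := n) hk (by omega)
      (bOp_cOp_mem_of_add_ne_zero hW hL (k := -n) (j := -k) (by omega) (by omega) hx)
    rwa [cOp_bOp, if_pos rfl, cOp_cOp, (hN n hnN).2, map_zero, neg_zero, map_zero, sub_zero] at h
  · exact bOp_cOp_mem_of_add_ne_zero hW hL hk hkj hx

lemma up_down_mem (hW : ∀ x ∈ U, modeOp (fun k => (k : ℂ) ^ 2) 0 x ∈ U)
    (hL : ∀ m, ∀ x ∈ U, modeOp (fun k => -(k : ℂ)) m x ∈ U) {i j : BCIndex}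
    (hi : i ≠ Sum.inl 0) {x : FockF} (hx : x ∈ U) : up i (down j x) ∈ U := by
  obtain ⟨k, rfl⟩ := modeIdx_surjective i
  obtain ⟨n, rfl⟩ := modeIdx_surjective j
  rw [← modeIdx_zero, modeIdx_injective.ne_iff] at hi
  rw [← bOp_eq_up, ← cOp_neg_eq_down]
  exact bOp_cOp_mem hW hL hi hx

end Invariant

/-- The wedge monomial of a list of basis indices. -/
def monoL (L : List BCIndex) : FockF := (L.map fun i => ι ℂ (bv i)).prod

/-- The wedge monomial of a finite set of basis indices, in some order. -/
def mono (A : Finset BCIndex) : FockF := monoL A.toList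

lemma monoL_cons (i : BCIndex) (L : List BCIndex) : monoL (i :: L) = cre i (monoL L) := by
  simp [monoL, cre]

lemma ann_monoL_nil (i : BCIndex) : ann i (monoL []) = 0 :=
  CliffordAlgebra.contractLeft_one (Q := (0 : QuadraticForm ℂ BCSpace)) _

lemma cre_monoL {i : BCIndex} {L : List BCIndex} (h : i ∈ L) : cre i (monoL L) = 0 := by
  induction L with
  | nil => simp at h
  | cons j L ih =>
    rw [monoL_cons]
    rcases List.mem_cons.1 h with rfl | h
    · exact cre_self _ _
    · rw [cre_cre, ih h, map_zero, neg_zero]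

lemma ann_monoL {i : BCIndex} {L : List BCIndex} (h : i ∉ L) : ann i (monoL L) = 0 := by
  induction L with
  | nil => exact ann_monoL_nil i
  | cons j L ih =>
    rw [List.mem_cons, not_or] at h
    rw [monoL_cons, ann_cre, if_neg h.1, ih h.2, map_zero, sub_zero]

lemma monoL_eq_zero {L : List BCIndex} (h : ¬ L.Nodup) : monoL L = 0 := by
  induction L with
  | nil => simp at h
  | cons j L ih =>
    rw [monoL_cons]
    by_cases hj : j ∈ L
    · exact cre_monoL hj
    · rw [ih (by simpa [hj] using h), map_zero]

lemma monoL_mem_span_of_perm {L L' : List BCIndex} (h : L.Perm L') :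
    monoL L ∈ Submodule.span ℂ {monoL L'} := by
  induction h with
  | nil => exact Submodule.mem_span_singleton_self _
  | cons i _ ih =>
    obtain ⟨r, hr⟩ := Submodule.mem_span_singleton.1 ih
    exact Submodule.mem_span_singleton.2 ⟨r, by rw [monoL_cons, monoL_cons, ← hr, map_smul]⟩
  | swap i j L =>
    refine Submodule.mem_span_singleton.2 ⟨-1, ?_⟩
    simp only [monoL_cons]
    rw [cre_cre j i]
    simp
  | trans _ _ h₁ h₂ =>
    exact (Submodule.span_singleton_le_iff_mem _ _).2 h₂ h₁

lemma cre_mono {i : BCIndex} {A : Finset BCIndex} (h : i ∈ A) : cre i (mono A) = 0 :=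
  cre_monoL (by simpa using h)

lemma ann_mono {i : BCIndex} {A : Finset BCIndex} (h : i ∉ A) : ann i (mono A) = 0 :=
  ann_monoL (by simpa using h)

/-- Removal of an element from, or addition to, a finite set of modes. -/
def flipMode (A : Finset BCIndex) (i : BCIndex) : Finset BCIndex :=
  if i ∈ A then A.erase i else insert i A

lemma cre_mono_mem (i : BCIndex) (A : Finset BCIndex) :
    cre i (mono A) ∈ Submodule.span ℂ {mono (flipMode A i)} := by
  unfold flipMode
  split_ifs with h
  · rw [cre_mono h]; exact zero_mem _
  · rw [mono, mono, ← monoL_cons]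
    exact monoL_mem_span_of_perm (Finset.toList_insert h).symm

lemma ann_mono_mem (i : BCIndex) (A : Finset BCIndex) :
    ann i (mono A) ∈ Submodule.span ℂ {mono (flipMode A i)} := by
  unfold flipMode
  split_ifs with h
  · have hp : mono A ∈ Submodule.span ℂ {cre i (mono (A.erase i))} := by
      have := monoL_mem_span_of_perm (Finset.toList_insert (Finset.notMem_erase i A))
      rwa [Finset.insert_erase h, monoL_cons] at this
    obtain ⟨r, hr⟩ := Submodule.mem_span_singleton.1 hp
    refine Submodule.mem_span_singleton.2 ⟨r, ?_⟩
    rw [← hr, map_smul, ann_cre, if_pos rfl, ann_mono (Finset.notMem_erase i A), map_zero,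
      sub_zero]
  · rw [ann_mono h]; exact zero_mem _

lemma up_mono_mem (i : BCIndex) (A : Finset BCIndex) :
    up i (mono A) ∈ Submodule.span ℂ {mono (flipMode A i)} := by
  rcases i with i | i
  · exact cre_mono_mem _ _
  · exact ann_mono_mem _ _

lemma down_mono_mem (i : BCIndex) (A : Finset BCIndex) :
    down i (mono A) ∈ Submodule.span ℂ {mono (flipMode A i)} := by
  rcases i with i | i
  · exact ann_mono_mem _ _
  · exact cre_mono_mem _ _

/-- The mode `i` carries a unit of charge in the state `mono A`, relative to the state
in which it carries none. -/
def Occ (A : Finset BCIndex) (i : BCIndex) : Prop := (i ∈ A) = (i.isLeft = true)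

lemma up_mono {i : BCIndex} {A : Finset BCIndex} (h : Occ A i) : up i (mono A) = 0 := by
  rcases i with i | i
  · exact cre_mono (by simpa [Occ] using h)
  · exact ann_mono (by simpa [Occ] using h)

lemma down_mono {i : BCIndex} {A : Finset BCIndex} (h : ¬ Occ A i) : down i (mono A) = 0 := by
  rcases i with i | i
  · exact ann_mono (by simpa [Occ] using h)
  · exact cre_mono (by simpa [Occ] using h)

lemma up_down_mono_of_occ {i : BCIndex} {A : Finset BCIndex} (h : Occ A i) :
    up i (down i (mono A)) = mono A := by
  rw [up_down, if_pos rfl, up_mono h, map_zero, sub_zero]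

lemma up_down_mono_of_not_occ {i : BCIndex} {A : Finset BCIndex} (h : ¬ Occ A i) :
    up i (down i (mono A)) = 0 := by
  rw [down_mono h, map_zero]

lemma up_down_up_down_mono {i j : BCIndex} {A : Finset BCIndex} (hi : Occ A i)
    (hj : ¬ Occ A j) : up i (down j (up j (down i (mono A)))) = mono A := by
  have h : down j (up j (down i (mono A))) = down i (mono A) := by
    have := up_down j j (down i (mono A))
    rw [if_pos rfl, down_down, down_mono hj, map_zero, neg_zero, map_zero] at this
    exact (sub_eq_zero.1 this.symm).symm
  rw [h, up_down_mono_of_occ hi]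

/-- The charge of a basis index: `1` for `v`-type and `-1` for `w`-type. -/
def sgn (i : BCIndex) : ℤ := if i.isLeft then 1 else -1

/-- The charge of the wedge monomial of a finite set of basis indices. -/
def charge (A : Finset BCIndex) : ℤ := ∑ i ∈ A, sgn i

lemma chargeOf_cons (i : BCIndex) (L : List BCIndex) :
    chargeOf (i :: L) = sgn i + chargeOf L := by
  rcases i with i | i <;> simp [chargeOf, sgn, List.countP_cons] <;> abel

lemma chargeOf_eq_sum (L : List BCIndex) : chargeOf L = (L.map sgn).sum := by
  induction L with
  | nil => simp [chargeOf]
  | cons i L ih => rw [chargeOf_cons, ih, List.map_cons, List.sum_cons]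

lemma chargeOf_toList (A : Finset BCIndex) : chargeOf A.toList = charge A := by
  rw [chargeOf_eq_sum, charge, Finset.sum_map_toList]

lemma monoL_mem_FF (L : List BCIndex) : monoL L ∈ FF (chargeOf L) :=
  Submodule.subset_span ⟨L, rfl, rfl⟩

lemma FF_induction {l : ℤ} {p : Submodule ℂ FockF} (T : Module.End ℂ FockF)
    (h : ∀ L, chargeOf L = l → T (monoL L) ∈ p) : ∀ x ∈ FF l, T x ∈ p := by
  suffices FF l ≤ p.comap T from fun x hx => this hx
  refine Submodule.span_le.2 ?_
  rintro _ ⟨L, hL, rfl⟩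
  exact h L hL

lemma cre_mem_FF (i : BCIndex) {l : ℤ} : ∀ x ∈ FF l, cre i x ∈ FF (l + sgn i) := by
  refine FF_induction _ fun L hL => ?_
  rw [← monoL_cons, ← hL, add_comm, ← chargeOf_cons]
  exact monoL_mem_FF _

lemma ann_mem_FF (i : BCIndex) {l : ℤ} : ∀ x ∈ FF l, ann i x ∈ FF (l - sgn i) := by
  refine FF_induction _ fun L hL => ?_
  subst hL
  induction L with
  | nil => rw [ann_monoL_nil]; exact zero_mem _
  | cons j L ih =>
    rw [monoL_cons, ann_cre, chargeOf_cons]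
    refine sub_mem ?_ ?_
    · split_ifs with h
      · rw [h, add_sub_cancel_left]; exact monoL_mem_FF _
      · exact zero_mem _
    · convert cre_mem_FF j _ ih using 2
      ring

lemma up_mem_FF (i : BCIndex) {l : ℤ} {x : FockF} (hx : x ∈ FF l) : up i x ∈ FF (l + 1) := by
  rcases i with i | i
  · exact cre_mem_FF (Sum.inl i) x hx
  · exact ann_mem_FF (Sum.inr i) x hx

lemma down_mem_FF (i : BCIndex) {l : ℤ} {x : FockF} (hx : x ∈ FF l) :
    down i x ∈ FF (l - 1) := by
  rcases i with i | i
  · exact ann_mem_FF (Sum.inl i) x hx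
  · exact cre_mem_FF (Sum.inr i) x hx

lemma nbc_mem_FF (k j : ℤ) {l : ℤ} {x : FockF} (hx : x ∈ FF l) : nbc k j x ∈ FF l := by
  unfold nbc
  rw [bOp_eq_up, cOp_eq_down]
  split_ifs
  · have := down_mem_FF (modeIdx (-j)) (up_mem_FF (modeIdx k) hx)
    rw [add_sub_cancel_right] at this
    exact neg_mem this
  · have := up_mem_FF (modeIdx k) (down_mem_FF (modeIdx (-j)) hx)
    rwa [sub_add_cancel] at this

lemma cOp_zero_nbc {k : ℤ} (hk : k ≠ 0) (j : ℤ) {x : FockF} (hx : cOp 0 x = 0) :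
    cOp 0 (nbc k j x) = 0 := by
  unfold nbc
  split_ifs <;> simp [cOp_cOp 0 j, cOp_bOp k 0, hk, hx]

lemma modeOp_mem_FFbar {f : ℤ → ℂ} (hf : f 0 = 0) (m : ℤ) {l : ℤ} {x : FockF}
    (hx : x ∈ FFbar l) : modeOp f m x ∈ FFbar l := by
  rw [modeOp_apply]
  refine finsum_induction (· ∈ FFbar l) (zero_mem _) (fun _ _ => add_mem) fun k => ?_
  by_cases hk : k = 0
  · rw [hk, hf, zero_smul]; exact zero_mem _
  · exact Submodule.smul_mem _ _ ⟨nbc_mem_FF _ _ hx.1, cOp_zero_nbc hk _ hx.2⟩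

lemma FFbar_le_span (l : ℤ) :
    FFbar l ≤ Submodule.span ℂ (mono '' {A | Sum.inl 0 ∉ A ∧ charge A = l}) := by
  rintro x ⟨hx, hc⟩
  have hx0 : cOp 0 (bOp 0 x) = x := by
    rw [cOp_bOp, if_pos (by simp), show cOp 0 x = 0 from hc, map_zero, sub_zero]
  rw [← hx0]
  have h0 : cOp 0 = ann (Sum.inl 0) := by rw [cOp_eq_down, neg_zero, modeIdx_zero]; rfl
  have h1 : bOp 0 = cre (Sum.inl 0) := by rw [bOp_eq_up, modeIdx_zero]; rfl
  refine FF_induction (cOp 0 ∘ₗ bOp 0) (fun L hL => ?_) x hx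
  rw [LinearMap.comp_apply, h0, h1]
  by_cases h : Sum.inl 0 ∈ L
  · rw [cre_monoL h, map_zero]; exact zero_mem _
  · rw [ann_cre, if_pos rfl, ann_monoL h, map_zero, sub_zero]
    by_cases hn : L.Nodup
    · have hp : L.Perm L.toFinset.toList := by
        rw [List.perm_ext_iff_of_nodup hn (Finset.nodup_toList _)]
        simp
      refine Submodule.span_mono ?_ (monoL_mem_span_of_perm hp)
      rw [Set.singleton_subset_iff]
      refine ⟨L.toFinset, ⟨by simpa using h, ?_⟩, rfl⟩
      rw [← chargeOf_toList, chargeOf_eq_sum, ← hL, chargeOf_eq_sum]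
      exact (hp.map sgn).sum_eq.symm
    · rw [monoL_eq_zero hn]; exact zero_mem _

lemma charge_flipMode_of_occ {i : BCIndex} {A : Finset BCIndex} (h : Occ A i) :
    charge (flipMode A i) = charge A - 1 := by
  unfold charge flipMode
  rcases i with i | i
  · have hi : Sum.inl i ∈ A := by simpa [Occ] using h
    rw [if_pos hi, ← Finset.add_sum_erase _ _ hi]
    simp [sgn]
  · have hi : Sum.inr i ∉ A := by simpa [Occ] using h
    rw [if_neg hi, Finset.sum_insert hi]
    simp [sgn]; ring

lemma charge_flipMode_of_not_occ {i : BCIndex} {A : Finset BCIndex} (h : ¬ Occ A i) :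
    charge (flipMode A i) = charge A + 1 := by
  unfold charge flipMode
  rcases i with i | i
  · have hi : Sum.inl i ∉ A := by simpa [Occ] using h
    rw [if_neg hi, Finset.sum_insert hi]
    simp [sgn]; ring
  · have hi : Sum.inr i ∈ A := by simpa [Occ] using h
    rw [if_pos hi, ← Finset.add_sum_erase _ _ hi]
    simp [sgn]

lemma occ_flipMode_of_ne {i j : BCIndex} (h : j ≠ i) (A : Finset BCIndex) :
    Occ (flipMode A i) j ↔ Occ A j := by
  unfold Occ flipMode
  split_ifs <;> simp [h]

lemma symmDiff_flipMode {i : BCIndex} {A B : Finset BCIndex} (h : i ∈ symmDiff A B) :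
    symmDiff (flipMode A i) B = (symmDiff A B).erase i := by
  unfold flipMode
  ext j
  simp only [Finset.mem_symmDiff] at h
  split_ifs <;> simp only [Finset.mem_symmDiff, Finset.mem_erase, Finset.mem_insert] <;> grind

lemma mem_symmDiff_of_occ {i : BCIndex} {A B : Finset BCIndex} (h : ¬ (Occ A i ↔ Occ B i)) :
    i ∈ symmDiff A B := by
  unfold Occ at h
  rw [Finset.mem_symmDiff]
  grind

lemma exists_occ_of_charge_eq {A B : Finset BCIndex} (hAB : A ≠ B) (h : charge A = charge B) :
    (∃ i, Occ A i ∧ ¬ Occ B i) ∧ ∃ j, ¬ Occ A j ∧ Occ B j := by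
  classical
  set δ : BCIndex → ℤ := fun i => sgn i * ((if i ∈ A then 1 else 0) - if i ∈ B then 1 else 0)
  have hsum : ∑ i ∈ A ∪ B, δ i = 0 := by
    simp only [δ, mul_sub, Finset.sum_sub_distrib, mul_ite, mul_one, mul_zero,
      Finset.sum_ite_mem]
    simpa [Finset.union_inter_cancel_left, Finset.union_inter_cancel_right, sub_eq_zero, charge] using h
  obtain ⟨t, ht⟩ : ∃ t, ¬ (t ∈ A ↔ t ∈ B) := by
    by_contra! hc
    exact hAB (Finset.ext hc)
  have hne : ∃ i ∈ A ∪ B, δ i ≠ 0 := by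
    refine ⟨t, by rw [Finset.mem_union]; tauto, ?_⟩
    simp only [δ, sgn]
    grind
  have hpos : ∀ i, 0 < δ i → Occ A i ∧ ¬ Occ B i := by
    rintro (i | i) <;> simp only [δ, sgn, Occ, Sum.isLeft] <;> grind
  have hneg : ∀ i, 0 < -δ i → ¬ Occ A i ∧ Occ B i := by
    rintro (i | i) <;> simp only [δ, sgn, Occ, Sum.isLeft] <;> grind
  obtain ⟨i, -, hi⟩ := Finset.exists_pos_of_sum_zero_of_exists_nonzero δ hsum hne
  obtain ⟨j, -, hj⟩ := Finset.exists_pos_of_sum_zero_of_exists_nonzero (fun i => -δ i)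
    (by rw [Finset.sum_neg_distrib, hsum, neg_zero]) (by simpa using hne)
  exact ⟨⟨i, hpos i hi⟩, j, hneg j hj⟩

section Irreducible

variable {U : Submodule ℂ FockF}

lemma mono_mem_of_charge_eq
    (hU : ∀ i j : BCIndex, i ≠ Sum.inl 0 → ∀ x ∈ U, up i (down j x) ∈ U)
    {A : Finset BCIndex} (hA0 : Sum.inl 0 ∉ A) (hA : mono A ∈ U) :
    ∀ B : Finset BCIndex, Sum.inl 0 ∉ B → charge B = charge A → mono B ∈ U := by
  intro B
  induction hn : (symmDiff B A).card using Nat.strong_induction_on generalizing B with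
  | _ n ih =>
    intro hB0 hBA
    by_cases hne : B = A
    · rwa [hne]
    obtain ⟨⟨i, hiB, hiA⟩, j, hjB, hjA⟩ := exists_occ_of_charge_eq hne hBA
    have hij : j ≠ i := by rintro rfl; exact hjB hiB
    have hiD : i ∈ symmDiff B A := mem_symmDiff_of_occ (by tauto)
    have hjD : j ∈ symmDiff B A := mem_symmDiff_of_occ (by tauto)
    have hne0 : ∀ t ∈ symmDiff B A, t ≠ Sum.inl 0 := by
      rintro _ ht rfl
      rw [Finset.mem_symmDiff] at ht
      tauto
    have hjD' : j ∈ symmDiff (flipMode B i) A := by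
      rw [symmDiff_flipMode hiD]
      exact Finset.mem_erase.2 ⟨hij, hjD⟩
    have hD : symmDiff (flipMode (flipMode B i) j) A = ((symmDiff B A).erase i).erase j := by
      rw [symmDiff_flipMode hjD', symmDiff_flipMode hiD]
    have hC : mono (flipMode (flipMode B i) j) ∈ U := by
      refine ih _ ?_ _ rfl ?_ ?_
      · rw [hD, ← hn]
        exact (Finset.card_le_card (Finset.erase_subset _ _)).trans_lt
          (Finset.card_erase_lt_of_mem hiD)
      · intro h0
        have : Sum.inl 0 ∈ symmDiff (flipMode (flipMode B i) j) A :=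
          Finset.mem_symmDiff.2 (Or.inl ⟨h0, hA0⟩)
        rw [hD] at this
        exact hne0 _ (Finset.mem_of_mem_erase (Finset.mem_of_mem_erase this)) rfl
      · rw [charge_flipMode_of_not_occ ((occ_flipMode_of_ne hij B).not.2 hjB),
          charge_flipMode_of_occ hiB, sub_add_cancel, hBA]
    have hmem : up j (down i (mono B)) ∈ U := by
      obtain ⟨r, hr⟩ := Submodule.mem_span_singleton.1 (down_mono_mem i B)
      obtain ⟨s, hs⟩ := Submodule.mem_span_singleton.1 (up_mono_mem j (flipMode B i))
      rw [← hr, map_smul, ← hs]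
      exact U.smul_mem _ (U.smul_mem _ hC)
    have := hU i j (hne0 i hiD) _ hmem
    rwa [up_down_up_down_mono hiB hjB] at this

lemma exists_mono_mem
    (hU : ∀ i j : BCIndex, i ≠ Sum.inl 0 → ∀ x ∈ U, up i (down j x) ∈ U)
    (a : Finset BCIndex → ℂ) (T : Finset (Finset BCIndex)) (hT : ∀ A ∈ T, Sum.inl 0 ∉ A)
    (hmem : ∑ A ∈ T, a A • mono A ∈ U) (hne : ∑ A ∈ T, a A • mono A ≠ 0) :
    ∃ A ∈ T, mono A ∈ U := by
  classical
  induction T using Finset.strongInduction with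
  | H T ih =>
    by_cases hsub : (T : Set (Finset BCIndex)).Subsingleton
    · obtain ⟨A, hA⟩ : T.Nonempty := by
        rw [Finset.nonempty_iff_ne_empty]
        rintro rfl
        simp at hne
      obtain rfl : T = {A} := Finset.eq_singleton_iff_unique_mem.2
        ⟨hA, fun B hB => hsub hB hA⟩
      rw [Finset.sum_singleton] at hmem hne
      exact ⟨A, hA, (U.smul_mem_iff (left_ne_zero_of_smul hne)).1 hmem⟩
    · obtain ⟨A, hA, B, hB, hAB⟩ := Set.not_subsingleton_iff.1 hsub
      obtain ⟨i, hi⟩ : ∃ i, ¬ (i ∈ A ↔ i ∈ B) := by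
        by_contra! hc
        exact hAB (Finset.ext hc)
      have hi0 : i ≠ Sum.inl 0 := by
        rintro rfl
        have := hT A hA
        have := hT B hB
        tauto
      have hocc : ¬ (Occ A i ↔ Occ B i) := by
        unfold Occ
        grind
      have hsplit := Finset.sum_filter_add_sum_filter_not T (fun C => Occ C i)
        fun C => a C • mono C
      have hproj : up i (down i (∑ C ∈ T, a C • mono C)) =
          ∑ C ∈ T with Occ C i, a C • mono C := by
        rw [map_sum, map_sum, Finset.sum_filter]
        refine Finset.sum_congr rfl fun C _ => ?_
        rw [map_smul, map_smul]
        split_ifs with h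
        · rw [up_down_mono_of_occ h]
        · rw [up_down_mono_of_not_occ h, smul_zero]
      have hmem₁ := hU i i hi0 _ hmem
      rw [hproj] at hmem₁
      by_cases h0 : ∑ C ∈ T with Occ C i, a C • mono C = 0
      · rw [h0, zero_add] at hsplit
        rw [← hsplit] at hmem hne
        have hss : (T.filter fun C => ¬ Occ C i) ⊂ T := by
          rw [Finset.filter_ssubset]
          by_cases h : Occ A i
          · exact ⟨A, hA, not_not.2 h⟩
          · exact ⟨B, hB, by tauto⟩
        obtain ⟨C, hC, hCU⟩ := ih _ hss (fun C hC => hT C (Finset.mem_of_mem_filter C hC))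
          hmem hne
        exact ⟨C, Finset.mem_of_mem_filter C hC, hCU⟩
      · have hss : (T.filter fun C => Occ C i) ⊂ T := by
          rw [Finset.filter_ssubset]
          by_cases h : Occ A i
          · exact ⟨B, hB, by tauto⟩
          · exact ⟨A, hA, h⟩
        obtain ⟨C, hC, hCU⟩ := ih _ hss (fun C hC => hT C (Finset.mem_of_mem_filter C hC))
          hmem₁ h0
        exact ⟨C, Finset.mem_of_mem_filter C hC, hCU⟩

lemma eq_FFbar_of_up_down_mem {l : ℤ} (hle : U ≤ FFbar l) (hbot : U ≠ ⊥)
    (hU : ∀ i j : BCIndex, i ≠ Sum.inl 0 → ∀ x ∈ U, up i (down j x) ∈ U) : U = FFbar l := by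
  obtain ⟨x, hxU, hx0⟩ := U.ne_bot_iff.1 hbot
  obtain ⟨a, ha, rfl⟩ := (Finsupp.mem_span_image_iff_linearCombination ℂ).1
    (FFbar_le_span l (hle hxU))
  have ha' := (Finsupp.mem_supported ℂ a).1 ha
  obtain ⟨A, hA, hAU⟩ := exists_mono_mem hU a a.support (fun A hA => (ha' hA).1) hxU hx0
  refine le_antisymm hle ((FFbar_le_span l).trans (Submodule.span_le.2 ?_))
  rintro _ ⟨B, ⟨hB0, hB⟩, rfl⟩
  exact mono_mem_of_charge_eq hU (ha' hA).1 hAU B hB0 (hB.trans (ha' hA).2.symm)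

end Irreducible

lemma Lmode_eq (m : ℤ) (x : FockF) : Lmode m x = modeOp (fun k => -(k : ℂ)) m x := rfl

lemma Wmode_eq (m : ℤ) (x : FockF) :
    Wmode m x = modeOp (fun k => (1 / 2 : ℂ) * k * (2 * k - m)) m x := rfl

/-- `F̄^l` is an irreducible module over the `W_3` algebra with central charge `−2`
realized by the modes `L_m`, `W̃_m`. -/
theorem Flbar_invariant_and_irreducible (l : ℤ) :
    (∀ m : ℤ, ∀ x ∈ FFbar l, Lmode m x ∈ FFbar l ∧ Wmode m x ∈ FFbar l) ∧
    (∀ U : Submodule ℂ FockF, U ≤ FFbar l → U ≠ ⊥ →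
      (∀ m : ℤ, ∀ x ∈ U, Lmode m x ∈ U) →
      (∀ m : ℤ, ∀ x ∈ U, Wmode m x ∈ U) →
      U = FFbar l) := by
  refine ⟨fun m x hx => ⟨?_, ?_⟩, fun U hle hbot hL hW => ?_⟩
  · rw [Lmode_eq]
    exact modeOp_mem_FFbar (by simp) m hx
  · rw [Wmode_eq]
    exact modeOp_mem_FFbar (by simp) m hx
  · have hW₀ : ∀ x ∈ U, modeOp (fun k => (k : ℂ) ^ 2) 0 x ∈ U := by
      intro x hx
      have h := hW 0 x hx
      rw [Wmode_eq] at h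
      convert h using 3
      funext k
      push_cast
      ring
    exact eq_FFbar_of_up_down_mem hle hbot fun i j hi x hx => up_down_mem hW₀ hL hi hx
end
end

section
/- Let F be the fermionic Fock space of the bc-system with the operators L_0 and W̃_0 and the subspaces F̄^l defined in the context. For every l ∈ ℤ, every natural number N and every integer M, the complex dimension of the joint eigenspace {x ∈ F̄^l : L_0 x = N·x and W̃_0 x = M·x} equals the number of pairs (A, B) of finite sets of positive integers such that |A| − |B| = l, Σ_{a∈A} a + Σ_{b∈B} b = N, and Σ_{a∈A} a² − Σ_{b∈B} b² = M. (This is the statement that the full character Tr_{⊕_l F̄^l} z^{−j₀} q^{L_0} p^{W̃_0} equals ∏_{n≥1}(1 + z q^n p^{n²})(1 + z^{−1} q^n p^{−n²}).) -/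
noncomputable section

open ExteriorAlgebra

/-- The wedge monomial attached to a list of basis indices. -/
def wedge (L : List BCIndex) : FockF := (L.map fun i => ι ℂ (bv i)).prod

/-- Contraction with the functional dual to the basis vector `i`. -/
def annihilate (i : BCIndex) : Module.End ℂ FockF := CliffordAlgebra.contractLeft (bvDual i)

/-- The occupation number operator of the basis vector `i`. -/
def occupation (i : BCIndex) : Module.End ℂ FockF :=
  LinearMap.mulLeft ℂ (ι ℂ (bv i)) ∘ₗ annihilate i

lemma occupation_apply (i : BCIndex) (x : FockF) :
    occupation i x = ι ℂ (bv i) * annihilate i x := rfl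

lemma annihilate_ι_mul (i j : BCIndex) (x : FockF) :
    annihilate i (ι ℂ (bv j) * x) = (if j = i then x else 0) - ι ℂ (bv j) * annihilate i x := by
  have h : annihilate i (ι ℂ (bv j) * x)
      = bvDual i (bv j) • x - ι ℂ (bv j) * annihilate i x :=
    CliffordAlgebra.contractLeft_ι_mul ..
  rw [h]
  by_cases hij : j = i <;> simp [bvDual, bv, hij]

lemma annihilate_occupation (i : BCIndex) (x : FockF) :
    annihilate i (occupation i x) = annihilate i x := by
  have h : annihilate i (annihilate i x) = 0 := CliffordAlgebra.contractLeft_contractLeft ..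
  rw [occupation_apply, annihilate_ι_mul, h]
  simp

lemma occupation_eq_zero_iff (i : BCIndex) (x : FockF) :
    occupation i x = 0 ↔ annihilate i x = 0 := by
  refine ⟨fun h => ?_, fun h => by rw [occupation_apply, h, mul_zero]⟩
  rw [← annihilate_occupation, h, map_zero]

@[simp] lemma wedge_nil : wedge [] = 1 := rfl

@[simp] lemma wedge_cons (i : BCIndex) (L : List BCIndex) :
    wedge (i :: L) = ι ℂ (bv i) * wedge L := by simp [wedge]

lemma occupation_wedge (i : BCIndex) (L : List BCIndex) :
    occupation i (wedge L) = if i ∈ L.toFinset then wedge L else 0 := by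
  induction L with
  | nil =>
    rw [occupation_apply, wedge_nil, annihilate, CliffordAlgebra.contractLeft_one]
    simp
  | cons j L ih =>
    rw [occupation_apply, wedge_cons, annihilate_ι_mul, mul_sub, ← mul_assoc,
      eq_neg_of_add_eq_zero_left (ι_add_mul_swap (bv i) (bv j)), neg_mul, sub_neg_eq_add,
      mul_assoc, ← occupation_apply, ih]
    by_cases hij : j = i
    · subst hij
      have hz : ι ℂ (bv j) * occupation j (wedge L) = 0 := by
        rw [occupation_apply, ← mul_assoc, ι_sq_zero, zero_mul]
      rw [ih] at hz
      simp [hz]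
    · simp only [hij, if_false, zero_add, mul_ite, mul_zero, List.toFinset_cons, Finset.mem_insert,
        Ne.symm hij, false_or]

lemma ι_mul_wedge_of_mem {i : BCIndex} {L : List BCIndex} (h : i ∈ L) :
    ι ℂ (bv i) * wedge L = 0 := by
  have hz : ι ℂ (bv i) * occupation i (wedge L) = 0 := by
    rw [occupation_apply, ← mul_assoc, ι_sq_zero, zero_mul]
  rwa [occupation_wedge, if_pos (List.mem_toFinset.2 h)] at hz

lemma wedge_eq_zero_of_not_nodup {L : List BCIndex} (h : ¬ L.Nodup) : wedge L = 0 := by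
  induction L with
  | nil => simp at h
  | cons i L ih =>
    by_cases hi : i ∈ L
    · rw [wedge_cons, ι_mul_wedge_of_mem hi]
    · rw [wedge_cons, ih (fun hL => h (List.nodup_cons.2 ⟨hi, hL⟩)), mul_zero]

lemma wedge_ne_zero {L : List BCIndex} (h : L.Nodup) : wedge L ≠ 0 := by
  induction L with
  | nil => simp
  | cons i L ih =>
    obtain ⟨hi, hL⟩ := List.nodup_cons.1 h
    intro h0
    have hz : annihilate i (wedge L) = 0 := by
      rw [← occupation_eq_zero_iff, occupation_wedge, if_neg (by simpa using hi)]
    have := congrArg (annihilate i) h0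
    rw [wedge_cons, annihilate_ι_mul, hz] at this
    exact ih hL (by simpa using this)

lemma wedge_perm {L L' : List BCIndex} (h : L.Perm L') :
    wedge L = wedge L' ∨ wedge L = -wedge L' := by
  induction h with
  | nil => simp
  | cons i _ ih => rcases ih with h | h <;> simp [h]
  | swap i j L =>
    right
    rw [wedge_cons, wedge_cons, wedge_cons, wedge_cons, ← mul_assoc, ← mul_assoc, ← neg_mul,
      eq_neg_of_add_eq_zero_left (ι_add_mul_swap (bv j) (bv i))]
  | trans _ _ h₁ h₂ => rcases h₁ with h₁ | h₁ <;> rcases h₂ with h₂ | h₂ <;> simp [h₁, h₂]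

lemma span_range_wedge : Submodule.span ℂ (Set.range wedge) = ⊤ := by
  refine Submodule.eq_top_iff'.2 fun x => ?_
  induction x using CliffordAlgebra.left_induction with
  | algebraMap r =>
    rw [Algebra.algebraMap_eq_smul_one]
    exact Submodule.smul_mem _ _ (Submodule.subset_span ⟨[], rfl⟩)
  | add x y hx hy => exact Submodule.add_mem _ hx hy
  | ι_mul x m hx =>
    induction m using Finsupp.induction_linear with
    | zero => simp
    | add f g hf hg => rw [map_add, add_mul]; exact Submodule.add_mem _ hf hg
    | single i a =>
      have hs : (Finsupp.single i a : BCSpace) = a • bv i := by simp [bv]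
      rw [hs, map_smul, smul_mul_assoc]
      refine Submodule.smul_mem _ _ ?_
      clear hs
      induction hx using Submodule.span_induction with
      | mem y hy =>
        obtain ⟨L, rfl⟩ := hy
        exact Submodule.subset_span ⟨i :: L, wedge_cons i L⟩
      | zero => simp
      | add y z _ _ hy hz => rw [mul_add]; exact Submodule.add_mem _ hy hz
      | smul c y _ hy => rw [mul_smul_comm]; exact Submodule.smul_mem _ _ hy

/-- The wedge monomial attached to a finite set of basis indices, up to sign. -/
def finsetWedge (S : Finset BCIndex) : FockF := wedge S.toList

lemma occupation_finsetWedge (i : BCIndex) (S : Finset BCIndex) :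
    occupation i (finsetWedge S) = if i ∈ S then finsetWedge S else 0 := by
  simp [finsetWedge, occupation_wedge]

lemma occupation_commute (i j : BCIndex) : Commute (occupation i) (occupation j) := by
  refine LinearMap.ext_on_range span_range_wedge fun L => ?_
  simp only [Module.End.mul_apply, occupation_wedge]
  split_ifs <;> simp [occupation_wedge, *]

lemma linearIndependent_finsetWedge : LinearIndependent ℂ finsetWedge := by
  have hind := Module.End.independent_iInf_maxGenEigenspace_of_forall_mapsTo occupation
    fun i j φ => Module.End.mapsTo_maxGenEigenspace_of_comm (occupation_commute j i) φ
  have hinj : Function.Injective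
      fun (S : Finset BCIndex) (i : BCIndex) => if i ∈ S then (1 : ℂ) else 0 := by
    intro S T h
    ext i
    have := congrFun h i
    by_cases hS : i ∈ S <;> by_cases hT : i ∈ T <;> simp_all
  refine (hind.comp hinj).linearIndependent _ (fun S => ?_)
    fun S => wedge_ne_zero S.nodup_toList
  refine (Submodule.mem_iInf _).2 fun i => ?_
  have h : finsetWedge S ∈ (occupation i).eigenspace (if i ∈ S then (1 : ℂ) else 0) := by
    rw [Module.End.mem_eigenspace_iff, occupation_finsetWedge]
    split_ifs <;> simp
  exact (occupation i).genEigenspace_le_maximal _ 1 h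

lemma span_range_finsetWedge : ⊤ ≤ Submodule.span ℂ (Set.range finsetWedge) := by
  rw [← span_range_wedge, Submodule.span_le]
  rintro _ ⟨L, rfl⟩
  by_cases hL : L.Nodup
  · have hmem : finsetWedge L.toFinset ∈ Submodule.span ℂ (Set.range finsetWedge) :=
      Submodule.subset_span ⟨_, rfl⟩
    rcases wedge_perm (List.toFinset_toList hL).symm with h | h
    · rw [h]; exact hmem
    · rw [h]; exact Submodule.neg_mem _ hmem
  · rw [wedge_eq_zero_of_not_nodup hL]
    exact Submodule.zero_mem _

/-- The basis of the Fock space by wedge monomials. -/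
def fockBasis : Module.Basis (Finset BCIndex) ℂ FockF :=
  Module.Basis.mk linearIndependent_finsetWedge span_range_finsetWedge

lemma fockBasis_apply (S : Finset BCIndex) : fockBasis S = finsetWedge S := by
  simp [fockBasis]

lemma repr_occupation (i : BCIndex) (x : FockF) (S : Finset BCIndex) :
    fockBasis.repr (occupation i x) S = if i ∈ S then fockBasis.repr x S else 0 := by
  have h : Finsupp.lapply S ∘ₗ fockBasis.repr.toLinearMap ∘ₗ occupation i
      = (if i ∈ S then (1 : ℂ) else 0) • (Finsupp.lapply S ∘ₗ fockBasis.repr.toLinearMap) := by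
    refine fockBasis.ext fun T => ?_
    have hT : occupation i (fockBasis T) = if i ∈ T then fockBasis T else 0 := by
      rw [fockBasis_apply, occupation_finsetWedge]
    simp only [LinearMap.comp_apply, hT, LinearMap.smul_apply]
    by_cases hST : T = S
    · subst hST; split_ifs <;> simp
    · split_ifs <;> simp [hST]
  have := LinearMap.congr_fun h x
  split_ifs at this ⊢ <;> simpa using this

lemma repr_finsum_occupation (f : BCIndex → ℂ) (x : FockF) (S : Finset BCIndex) :
    fockBasis.repr (∑ᶠ i, f i • occupation i x) S = (∑ i ∈ S, f i) * fockBasis.repr x S := by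
  have hfin : (Function.support fun i => f i • occupation i x).Finite := by
    refine ((fockBasis.repr x).support.biUnion id).finite_toSet.subset fun i hi => ?_
    by_contra hn
    refine hi ?_
    have : occupation i x = 0 := by
      refine fockBasis.repr.injective (Finsupp.ext fun T => ?_)
      rw [repr_occupation]
      by_cases hT : i ∈ T
      · have : fockBasis.repr x T = 0 := by
          by_contra h0
          exact hn (by simpa using ⟨T, h0, hT⟩)
        simp [this]
      · simp [hT]
    simp [this]
  have h := map_finsum (Finsupp.lapply S ∘ₗ fockBasis.repr.toLinearMap) hfin
  simp only [LinearMap.comp_apply, LinearEquiv.coe_coe, Finsupp.lapply_apply] at h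
  rw [h, finsum_eq_sum_of_support_subset (s := S), Finset.sum_mul]
  · refine Finset.sum_congr rfl fun i hi => ?_
    simp [repr_occupation, hi]
  · intro i hi
    by_contra hn
    exact hi (by simp only [Finset.mem_coe] at hn; simp [repr_occupation, hn])

/-- The basis index created or annihilated by the `k`-th mode. -/
def modeEquiv : ℤ ≃ BCIndex where
  toFun k := if k ≤ 0 then Sum.inl (-k).toNat else Sum.inr (k - 1).toNat
  invFun := Sum.elim (fun n => -(n : ℤ)) (fun n => (n : ℤ) + 1)
  left_inv k := by
    by_cases h : k ≤ 0
    · simp [h]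
    · simp only [h, if_false, Sum.elim_inr]; omega
  right_inv i := by
    rcases i with n | n
    · simp
    · have : ¬ ((n : ℤ) + 1 ≤ 0) := by omega
      simp [this]

lemma nbc_neg (k : ℤ) (x : FockF) :
    nbc k (0 - k) x = (if k ≤ 0 then (1 : ℂ) else -1) • occupation (modeEquiv k) x := by
  by_cases h : k ≤ 0
  · have h1 : ¬ (1 ≤ k ∧ 0 - k ≤ -1) := by omega
    have h2 : 0 ≤ 0 - k := by omega
    rw [nbc, if_neg h1, bOp, cOp, if_pos h, if_pos h2, if_pos h, one_smul, zero_sub]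
    simp only [modeEquiv, Equiv.coe_fn_mk, if_pos h]
    rfl
  · have h1 : 1 ≤ k ∧ 0 - k ≤ -1 := by omega
    have h2 : ¬ (0 ≤ 0 - k) := by omega
    have h3 : -(0 - k) - 1 = k - 1 := by omega
    simp only [nbc, h1, bOp, cOp, h, h2, h3, modeEquiv, if_true, if_false, Equiv.coe_fn_mk,
      neg_smul, one_smul, and_self]
    rfl

/-- The `L₀`-weight of a basis vector. -/
def weightL : BCIndex → ℕ := Sum.elim (fun n => n) (fun n => n + 1)

/-- The `W̃₀`-weight of a basis vector. -/
def weightW : BCIndex → ℤ := Sum.elim (fun n => (n : ℤ) ^ 2) (fun n => -((n + 1 : ℕ) : ℤ) ^ 2)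

lemma Lmode_zero (x : FockF) : Lmode 0 x = ∑ᶠ i, (weightL i : ℂ) • occupation i x := by
  rw [← finsum_comp_equiv modeEquiv, Lmode]
  refine finsum_congr fun k => ?_
  rw [nbc_neg, smul_smul]
  congr 1
  obtain ⟨i, rfl⟩ := modeEquiv.symm.surjective k
  rcases i with n | n
  · simp [modeEquiv, weightL]
  · have : ¬ ((n : ℤ) + 1 ≤ 0) := by omega
    simp [modeEquiv, weightL, this]

lemma Wmode_zero (x : FockF) : Wmode 0 x = ∑ᶠ i, (weightW i : ℂ) • occupation i x := by
  rw [← finsum_comp_equiv modeEquiv, Wmode]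
  refine finsum_congr fun k => ?_
  rw [nbc_neg, smul_smul]
  congr 1
  obtain ⟨i, rfl⟩ := modeEquiv.symm.surjective k
  rcases i with n | n
  · simp [modeEquiv, weightW]
    ring
  · have : ¬ ((n : ℤ) + 1 ≤ 0) := by omega
    simp [modeEquiv, weightW, this]
    ring

lemma mem_iff_repr_of_repr_eq_mul {g : FockF → FockF} {w : Finset BCIndex → ℂ}
    (hg : ∀ x S, fockBasis.repr (g x) S = w S * fockBasis.repr x S) (c : ℂ) (x : FockF) :
    g x = c • x ↔ ∀ S ∈ (fockBasis.repr x).support, w S = c := by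
  rw [← fockBasis.repr.injective.eq_iff, Finsupp.ext_iff]
  refine forall_congr' fun S => ?_
  rw [hg, map_smul, Finsupp.smul_apply, smul_eq_mul, mul_eq_mul_right_iff, Finsupp.mem_support_iff]
  tauto

lemma Lmode_zero_eq_iff (N : ℕ) (x : FockF) :
    Lmode 0 x = (N : ℂ) • x ↔ ∀ S ∈ (fockBasis.repr x).support, ∑ i ∈ S, weightL i = N := by
  rw [mem_iff_repr_of_repr_eq_mul (g := Lmode 0) fun x S => by
    rw [Lmode_zero, repr_finsum_occupation]]
  exact forall₂_congr fun S _ => by exact_mod_cast Iff.rfl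

lemma Wmode_zero_eq_iff (M : ℤ) (x : FockF) :
    Wmode 0 x = (M : ℂ) • x ↔ ∀ S ∈ (fockBasis.repr x).support, ∑ i ∈ S, weightW i = M := by
  rw [mem_iff_repr_of_repr_eq_mul (g := Wmode 0) fun x S => by
    rw [Wmode_zero, repr_finsum_occupation]]
  exact forall₂_congr fun S _ => by exact_mod_cast Iff.rfl

lemma mem_ker_cOp_zero_iff (x : FockF) :
    x ∈ LinearMap.ker (cOp 0) ↔ ∀ S ∈ (fockBasis.repr x).support, Sum.inl 0 ∉ S := by
  have h : cOp 0 = annihilate (Sum.inl 0) := by simp [cOp, annihilate]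
  rw [LinearMap.mem_ker, h, ← occupation_eq_zero_iff, ← fockBasis.repr.injective.eq_iff,
    Finsupp.ext_iff]
  refine forall_congr' fun S => ?_
  rw [repr_occupation, map_zero, Finsupp.zero_apply, Finsupp.mem_support_iff]
  split_ifs with hS <;> simp [hS]

lemma chargeOf_toList_s1 (S : Finset BCIndex) :
    chargeOf S.toList = (S.toLeft.card : ℤ) - S.toRight.card := by
  have hl : ∀ L : List BCIndex, chargeOf L = (L.map (Sum.elim (fun _ => 1) fun _ => -1)).sum := by
    intro L
    induction L with
    | nil => simp [chargeOf]
    | cons i L ih =>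
      rw [List.map_cons, List.sum_cons, ← ih]
      rcases i with n | n <;> simp [chargeOf, List.countP_cons] <;> ring
  rw [hl, Finset.sum_map_toList, Finset.sum_sum_eq_sum_toLeft_add_sum_toRight]
  simp [sub_eq_add_neg]

lemma FF_eq_span_image (l : ℤ) :
    FF l = Submodule.span ℂ (fockBasis '' {S | (S.toLeft.card : ℤ) - S.toRight.card = l}) := by
  refine le_antisymm (Submodule.span_le.2 ?_) (Submodule.span_le.2 ?_)
  · rintro _ ⟨L, hL, rfl⟩
    change wedge L ∈ _
    by_cases hn : L.Nodup
    · have hp := List.toFinset_toList hn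
      have hmem : finsetWedge L.toFinset ∈ Submodule.span ℂ
          (fockBasis '' {S | (S.toLeft.card : ℤ) - S.toRight.card = l}) := by
        refine Submodule.subset_span ⟨L.toFinset, ?_, fockBasis_apply _⟩
        rw [Set.mem_ofPred_eq, ← chargeOf_toList_s1, ← hL, chargeOf, chargeOf, hp.countP_eq,
          hp.countP_eq]
      rcases wedge_perm hp.symm with h | h
      · rw [h]; exact hmem
      · rw [h]; exact Submodule.neg_mem _ hmem
    · rw [wedge_eq_zero_of_not_nodup hn]
      exact Submodule.zero_mem _
  · rintro _ ⟨S, hS, rfl⟩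
    refine Submodule.subset_span ⟨S.toList, ?_, fockBasis_apply S⟩
    rw [chargeOf_toList_s1, hS]

/-- The index sets of the wedge monomials spanning the joint eigenspace. -/
def goodSets (l : ℤ) (N : ℕ) (M : ℤ) : Set (Finset BCIndex) :=
  {S | (S.toLeft.card : ℤ) - S.toRight.card = l ∧ Sum.inl 0 ∉ S ∧
    ∑ i ∈ S, weightL i = N ∧ ∑ i ∈ S, weightW i = M}

lemma jointEigenspace_eq (l : ℤ) (N : ℕ) (M : ℤ) :
    {x : FockF | x ∈ FFbar l ∧ Lmode 0 x = (N : ℂ) • x ∧ Wmode 0 x = (M : ℂ) • x}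
      = Submodule.span ℂ (fockBasis '' goodSets l N M) := by
  ext x
  rw [Set.mem_ofPred_eq, SetLike.mem_coe, FFbar, Submodule.mem_inf, FF_eq_span_image,
    Module.Basis.mem_span_image, Module.Basis.mem_span_image, mem_ker_cOp_zero_iff,
    Lmode_zero_eq_iff, Wmode_zero_eq_iff]
  simp only [Set.subset_def, goodSets, Set.mem_ofPred_eq, Finset.mem_coe]
  constructor
  · rintro ⟨⟨h₁, h₂⟩, h₃, h₄⟩ S hS
    exact ⟨h₁ S hS, h₂ S hS, h₃ S hS, h₄ S hS⟩
  · intro h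
    exact ⟨⟨fun S hS => (h S hS).1, fun S hS => (h S hS).2.1⟩,
      fun S hS => (h S hS).2.2.1, fun S hS => (h S hS).2.2.2⟩

lemma finrank_span_fockBasis_image (s : Set (Finset BCIndex)) :
    Module.finrank ℂ (Submodule.span ℂ (fockBasis '' s)) = Nat.card s := by
  have h : LinearIndependent ℂ fun S : s => fockBasis S :=
    fockBasis.linearIndependent.comp _ Subtype.val_injective
  rw [Set.image_eq_range]
  exact Module.finrank_eq_nat_card_basis (Module.Basis.span h)

lemma map_succ_image_pred {B : Finset ℕ} (hB : ∀ b ∈ B, 0 < b) :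
    (B.image Nat.pred).map ⟨Nat.succ, Nat.succ_injective⟩ = B := by
  ext b
  simp only [Finset.mem_map, Finset.mem_image, Function.Embedding.coeFn_mk]
  constructor
  · rintro ⟨_, ⟨c, hc, rfl⟩, rfl⟩
    rwa [Nat.succ_pred_eq_of_pos (hB c hc)]
  · intro hb
    exact ⟨b.pred, ⟨b, hb, rfl⟩, Nat.succ_pred_eq_of_pos (hB b hb)⟩

/-- The pair of finite sets of positive integers attached to a wedge monomial without `v₀`. -/
def toPair (S : Finset BCIndex) : Finset ℕ × Finset ℕ :=
  (S.toLeft, S.toRight.map ⟨Nat.succ, Nat.succ_injective⟩)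

lemma toPair_injective : Function.Injective toPair := by
  intro S T h
  obtain ⟨h₁, h₂⟩ := Prod.ext_iff.1 h
  exact Finset.sumEquiv.injective (Prod.ext h₁ (Finset.map_injective _ h₂))

lemma mem_goodSets_iff (l : ℤ) (N : ℕ) (M : ℤ) (S : Finset BCIndex) :
    S ∈ goodSets l N M ↔
      (∀ a ∈ (toPair S).1, 0 < a) ∧ (∀ b ∈ (toPair S).2, 0 < b) ∧
        ((toPair S).1.card : ℤ) - ((toPair S).2.card : ℤ) = l ∧
        (∑ a ∈ (toPair S).1, a) + (∑ b ∈ (toPair S).2, b) = N ∧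
        (∑ a ∈ (toPair S).1, (a : ℤ) ^ 2) - (∑ b ∈ (toPair S).2, (b : ℤ) ^ 2) = M := by
  have h0 : Sum.inl 0 ∉ S ↔ ∀ a ∈ S.toLeft, 0 < a := by
    simp only [Finset.mem_toLeft]
    exact ⟨fun h a ha => Nat.pos_of_ne_zero fun h' => h (h' ▸ ha), fun h h' => (h 0 h').false⟩
  rw [goodSets, Set.mem_ofPred_eq, h0, Finset.sum_sum_eq_sum_toLeft_add_sum_toRight,
    Finset.sum_sum_eq_sum_toLeft_add_sum_toRight]
  simp only [toPair, weightL, weightW, Sum.elim_inl, Sum.elim_inr, Finset.card_map,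
    Finset.sum_map, Function.Embedding.coeFn_mk, Finset.sum_neg_distrib, ← sub_eq_add_neg,
    Finset.mem_map, Nat.succ_eq_add_one]
  have hpos : ∀ b, (∃ a ∈ S.toRight, a + 1 = b) → 0 < b := by
    rintro _ ⟨a, _, rfl⟩
    exact a.succ_pos
  tauto

lemma card_goodSets (l : ℤ) (N : ℕ) (M : ℤ) :
    Nat.card (goodSets l N M) = Nat.card {p : Finset ℕ × Finset ℕ //
        (∀ a ∈ p.1, 0 < a) ∧ (∀ b ∈ p.2, 0 < b) ∧
        (p.1.card : ℤ) - (p.2.card : ℤ) = l ∧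
        (∑ a ∈ p.1, a) + (∑ b ∈ p.2, b) = N ∧
        (∑ a ∈ p.1, (a : ℤ) ^ 2) - (∑ b ∈ p.2, (b : ℤ) ^ 2) = M} := by
  refine Nat.card_eq_of_bijective
    (fun S => ⟨toPair S.1, (mem_goodSets_iff l N M S.1).1 S.2⟩) ⟨fun S T h => ?_, ?_⟩
  · exact Subtype.ext (toPair_injective (congrArg Subtype.val h))
  · rintro ⟨⟨A, B⟩, hp⟩
    have h : toPair (A.disjSum (B.image Nat.pred)) = (A, B) := by
      simp only [toPair, Finset.toLeft_disjSum, Finset.toRight_disjSum,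
        map_succ_image_pred hp.2.1]
    exact ⟨⟨A.disjSum (B.image Nat.pred), (mem_goodSets_iff l N M _).2 (by rwa [h])⟩,
      Subtype.ext h⟩

/-- The full character of `F̄^l`:
`Tr_{⊕_l F̄^l} z^{−j₀} q^{L₀} p^{W̃₀} = ∏_{n≥1}(1 + z qⁿ p^{n²})(1 + z⁻¹ qⁿ p^{−n²})`,
stated as: the dimension of the joint `(L₀, W̃₀)`-eigenspace of `F̄^l` with eigenvalues
`(N, M)` equals the number of pairs `(A, B)` of finite sets of positive integers with
`|A| − |B| = l`, `Σ A + Σ B = N` and `Σ_{a∈A} a² − Σ_{b∈B} b² = M`. -/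
theorem character_of_Flbar (l : ℤ) (N : ℕ) (M : ℤ) :
    Module.finrank ℂ
      ↥(Submodule.span ℂ
        {x : FockF | x ∈ FFbar l ∧ Lmode 0 x = (N : ℂ) • x ∧ Wmode 0 x = (M : ℂ) • x})
    = Nat.card {p : Finset ℕ × Finset ℕ //
        (∀ a ∈ p.1, 0 < a) ∧ (∀ b ∈ p.2, 0 < b) ∧
        (p.1.card : ℤ) - (p.2.card : ℤ) = l ∧
        (∑ a ∈ p.1, a) + (∑ b ∈ p.2, b) = N ∧
        (∑ a ∈ p.1, (a : ℤ) ^ 2) - (∑ b ∈ p.2, (b : ℤ) ^ 2) = M} := by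
  rw [jointEigenspace_eq, Submodule.span_eq, finrank_span_fockBasis_image, card_goodSets]
end
end

section
/- Let F be the fermionic Fock space of the bc-system, with the operators L_m, W_m = (2/√6)·W̃_m and Λ_m defined in the context. Then for all m, n ∈ ℤ, as operators on F: W_m ∘ W_n − W_n ∘ W_m = (m − n)·[(1/15)(m+n+3)(m+n+2) − (1/6)(m+2)(n+2)]·L_{m+n} + (4/3)(m − n)·Λ_{m+n} − (1/180)·m(m² − 1)(m² − 4)·δ_{m,−n}·id. (That is, the modes L_m and W_m satisfy the defining relations of the W_3 algebra with central charge c = −2, for which β = 16/(22 + 5c) = 4/3.) -/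
noncomputable section

open ExteriorAlgebra

/-- The modes `W_m = (2/√6)·W̃_m` of `W(z) = (1/√6)(:∂²b(z)c(z): − :∂b(z)∂c(z):)`. -/
def WW (m : ℤ) (x : FockF) : FockF := ((2 / Real.sqrt 6 : ℝ) : ℂ) • Wmode m x

/-- `Λ_m = Σ_{k ≤ −2} L_k L_{m−k} + Σ_{k ≥ −1} L_{m−k} L_k − (3/10)(m+2)(m+3) L_m`
(a finite sum on each vector). -/
def LambdaMode (m : ℤ) (x : FockF) : FockF :=
  (∑ᶠ k : ℤ, if k ≤ -2 then Lmode k (Lmode (m - k) x) else Lmode (m - k) (Lmode k x))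
    - ((3 / 10 : ℂ) * ((m : ℂ) + 2) * ((m : ℂ) + 3)) • Lmode m x

namespace BCFock

/-! ### Locally finite sums of operators -/

section LocallyFinite

variable {F : Type*} [AddCommGroup F] [Module ℂ F]

/-- A family of operators is locally finite if every vector is killed by all but finitely many
members. -/
def LocFin (T : ℤ → Module.End ℂ F) : Prop := ∀ x, (Function.support fun k => T k x).Finite

/-- `A` is the pointwise sum of the locally finite family `T`. -/
structure HasLSum (T : ℤ → Module.End ℂ F) (A : Module.End ℂ F) : Prop where
  locFin : LocFin T
  sum_eq : ∀ x, ∑ᶠ k, T k x = A x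

/-- The pointwise sum of a locally finite family of operators. -/
def lsum (T : ℤ → Module.End ℂ F) (h : LocFin T) : Module.End ℂ F where
  toFun x := ∑ᶠ k, T k x
  map_add' x y := by
    simp only [map_add]
    exact finsum_add_distrib (h x) (h y)
  map_smul' r x := by
    simp only [map_smul, RingHom.id_apply]
    exact (smul_finsum' r (h x)).symm

theorem hasLSum_lsum {T : ℤ → Module.End ℂ F} (h : LocFin T) : HasLSum T (lsum T h) :=
  ⟨h, fun _ => rfl⟩

theorem locFin_of_eventually {T : ℤ → Module.End ℂ F} (h₁ : ∀ x, ∃ N : ℤ, ∀ k > N, T k x = 0)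
    (h₂ : ∀ x, ∃ N : ℤ, ∀ k < N, T k x = 0) : LocFin T := by
  intro x
  obtain ⟨N, hN⟩ := h₁ x
  obtain ⟨N', hN'⟩ := h₂ x
  refine (Set.finite_Icc N' N).subset fun k hk => ?_
  rw [Function.mem_support] at hk
  refine ⟨?_, ?_⟩
  · by_contra hlt
    exact hk (hN' k (by omega))
  · by_contra hlt
    exact hk (hN k (by omega))

namespace HasLSum

variable {T T' : ℤ → Module.End ℂ F} {A A' : Module.End ℂ F}

theorem unique (h : HasLSum T A) (h' : HasLSum T A') : A = A' :=
  LinearMap.ext fun x => (h.sum_eq x).symm.trans (h'.sum_eq x)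

theorem add (h : HasLSum T A) (h' : HasLSum T' A') :
    HasLSum (fun k => T k + T' k) (A + A') where
  locFin x := ((h.locFin x).union (h'.locFin x)).subset (Function.support_add _ _)
  sum_eq x := by
    simp only [LinearMap.add_apply, ← h.sum_eq, ← h'.sum_eq]
    exact finsum_add_distrib (h.locFin x) (h'.locFin x)

theorem mul_left (h : HasLSum T A) (B : Module.End ℂ F) : HasLSum (fun k => B * T k) (B * A) where
  locFin x := (h.locFin x).subset fun k hk hk' => hk (by
    simp only at hk'
    simp [hk'])
  sum_eq x := by
    simp only [Module.End.mul_apply, ← h.sum_eq]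
    exact (map_finsum B (h.locFin x)).symm

theorem mul_right (h : HasLSum T A) (B : Module.End ℂ F) : HasLSum (fun k => T k * B) (A * B) where
  locFin x := h.locFin (B x)
  sum_eq x := h.sum_eq (B x)

theorem smul (h : HasLSum T A) (r : ℂ) : HasLSum (fun k => r • T k) (r • A) := by
  simpa using h.mul_left (r • 1)

theorem neg (h : HasLSum T A) : HasLSum (fun k => -T k) (-A) := by
  simpa using h.mul_left (-1)

theorem sub (h : HasLSum T A) (h' : HasLSum T' A') :
    HasLSum (fun k => T k - T' k) (A - A') := by
  simpa [sub_eq_add_neg] using h.add h'.neg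

theorem comp_equiv (h : HasLSum T A) (e : ℤ ≃ ℤ) : HasLSum (fun k => T (e k)) A where
  locFin x := (h.locFin x).preimage e.injective.injOn
  sum_eq x := (finsum_comp_equiv e (f := fun k => T k x)).trans (h.sum_eq x)

theorem congr (h : HasLSum T A) (hT : ∀ k, T' k = T k) : HasLSum T' A := by
  rwa [show T' = T from funext hT]

theorem apply_dual (h : HasLSum T A) (l : F →ₗ[ℂ] ℂ) (x : F) :
    l (A x) = ∑ᶠ k, l (T k x) := by
  rw [← h.sum_eq]
  exact map_finsum l (h.locFin x)

end HasLSum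

theorem hasLSum_single {T : ℤ → Module.End ℂ F} (k₀ : ℤ) (h : ∀ k, k ≠ k₀ → T k = 0) :
    HasLSum T (T k₀) where
  locFin x := (Set.finite_singleton k₀).subset fun k hk => by
    by_contra hne
    exact hk (by simp [h k hne])
  sum_eq x := finsum_eq_single _ k₀ fun k hk => by simp [h k hk]

theorem hasLSum_smul_one {s : ℤ → ℂ} (h : (Function.support s).Finite) :
    HasLSum (fun k => s k • (1 : Module.End ℂ F)) ((∑ᶠ k, s k) • 1) where
  locFin x := h.subset fun k hk hk' => hk (by simp [hk'])
  sum_eq x := by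
    simp only [LinearMap.smul_apply, Module.End.one_apply]
    exact (finsum_smul' h x).symm

theorem hasLSum_zero_of_antisymm {T : ℤ → Module.End ℂ F} (h : LocFin T) (e : ℤ ≃ ℤ)
    (he : ∀ k, T (e k) = -T k) : HasLSum T 0 := by
  have h₁ := hasLSum_lsum h
  have h₂ := (h₁.comp_equiv e).unique (h₁.neg.congr he)
  have h₃ : (2 : ℂ) • lsum T h = 0 := by
    rw [two_smul]
    exact eq_neg_iff_add_eq_zero.mp h₂
  rw [smul_eq_zero_iff_right two_ne_zero] at h₃
  rwa [h₃] at h₁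

end LocallyFinite

/-! ### Signed sums over integer intervals -/

/-- The indicator of `k ≤ B` minus the indicator of `k ≤ A`. -/
def signedInd (A B k : ℤ) : ℂ := (if k ≤ B then 1 else 0) - (if k ≤ A then 1 else 0)

theorem signedInd_support (A B : ℤ) (p : ℤ → ℂ) :
    (Function.support fun k => p k * signedInd A B k).Finite := by
  refine (Set.finite_Icc (min A B) (max A B)).subset fun k hk => ?_
  by_contra hc
  apply hk
  simp only [Set.mem_Icc, not_and_or, not_le, lt_min_iff, max_lt_iff] at hc
  unfold signedInd
  rcases hc with hc | hc
  · simp [hc.1.le, hc.2.le]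
  · simp [hc.1.not_ge, hc.2.not_ge]

theorem finsum_signedInd (P p : ℤ → ℂ) (hP : ∀ k, p k = P k - P (k - 1)) (A B : ℤ) :
    ∑ᶠ k, p k * signedInd A B k = P B - P A := by
  have step : ∀ B : ℤ, ∑ᶠ k, p k * signedInd A B k
      = (∑ᶠ k, p k * signedInd A (B - 1) k) + p B := by
    intro B
    have h1 : p B = ∑ᶠ k, p k * signedInd (B - 1) B k := by
      rw [finsum_eq_single _ B]
      · simp [signedInd]
      · intro k hk
        have : (k ≤ B) ↔ (k ≤ B - 1) := by omega
        simp [signedInd, this]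
    rw [h1, ← finsum_add_distrib (signedInd_support _ _ _) (signedInd_support _ _ _)]
    refine finsum_congr fun k => ?_
    simp only [signedInd]
    ring
  induction B using Int.inductionOn' (b := A) with
  | zero => simp [signedInd]
  | succ k hk ih =>
    rw [step, hP (k + 1), show k + 1 - 1 = k by ring, ih]
    ring
  | pred k hk ih =>
    rw [step, hP k] at ih
    linear_combination ih

/-! ### Modules over the bc-system -/

/-- An abstract vacuum module of the bc-system: modes `b n`, `c n` which satisfy the canonical
anticommutation relations, a vacuum `Ω` with its dual functional `vac` and a parity operator, such
that operators which commute or anticommute with all modes are detected by `vac`. -/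
structure VacuumModule (F : Type*) [AddCommGroup F] [Module ℂ F] where
  b : ℤ → Module.End ℂ F
  c : ℤ → Module.End ℂ F
  Ω : F
  vac : F →ₗ[ℂ] ℂ
  parity : Module.End ℂ F
  b_mul_b : ∀ m n, b m * b n + b n * b m = 0
  c_mul_c : ∀ m n, c m * c n + c n * c m = 0
  b_mul_c : ∀ m n, b m * c n + c n * b m = if m + n = 0 then 1 else 0
  eventually_zero : ∀ x, ∃ N : ℤ, ∀ k > N, b k x = 0 ∧ c k x = 0
  b_vacuum : ∀ n, 1 ≤ n → b n Ω = 0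
  c_vacuum : ∀ n, 0 ≤ n → c n Ω = 0
  vac_b : ∀ n, n ≤ 0 → ∀ x, vac (b n x) = 0
  vac_c : ∀ n, n ≤ -1 → ∀ x, vac (c n x) = 0
  vac_vacuum : vac Ω = 1
  parity_b : ∀ n, parity * b n = -(b n * parity)
  parity_c : ∀ n, parity * c n = -(c n * parity)
  vac_parity : ∀ x, vac (parity x) = vac x
  parity_vacuum : parity Ω = Ω
  eq_zero : ∀ (D : Module.End ℂ F) (s : ℂ), s ≠ 0 → (∀ n, D * b n = s • (b n * D)) →
    (∀ n, D * c n = s • (c n * D)) → vac (D Ω) = 0 → D = 0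

namespace VacuumModule

variable {F : Type*} [AddCommGroup F] [Module ℂ F] (M : VacuumModule F)

theorem vac_of_parity {X : Module.End ℂ F} (h : M.parity * X = -(X * M.parity)) :
    M.vac (X M.Ω) = 0 := by
  have h₁ := congrArg M.vac (LinearMap.congr_fun h M.Ω)
  rw [LinearMap.neg_apply, Module.End.mul_apply, Module.End.mul_apply, M.vac_parity,
    M.parity_vacuum, map_neg] at h₁
  exact self_eq_neg.mp h₁

theorem b_mul_b_comm (m n : ℤ) : M.b m * M.b n = -(M.b n * M.b m) :=
  eq_neg_of_add_eq_zero_left (M.b_mul_b m n)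

theorem c_mul_c_comm (m n : ℤ) : M.c m * M.c n = -(M.c n * M.c m) :=
  eq_neg_of_add_eq_zero_left (M.c_mul_c m n)

theorem c_mul_b (m n : ℤ) : M.c n * M.b m = (if m + n = 0 then 1 else 0) - M.b m * M.c n :=
  eq_sub_of_add_eq' (M.b_mul_c m n)

/-- The normally ordered product `:b(k)c(j):`. -/
def nbc (k j : ℤ) : Module.End ℂ F :=
  if 1 ≤ k ∧ j ≤ -1 then -(M.c j * M.b k) else M.b k * M.c j

theorem b_mul_c_eq_nbc (k j : ℤ) :
    M.b k * M.c j
      = M.nbc k j + ((if k + j = 0 then 1 else 0) * (if 1 ≤ k then 1 else 0) : ℂ) • 1 := by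
  have h := M.c_mul_b k j
  unfold nbc
  by_cases h₁ : k + j = 0
  · by_cases h₂ : 1 ≤ k
    · rw [if_pos ⟨h₂, by omega⟩, h]
      simp [h₁, h₂]
    · rw [if_neg (fun hc => h₂ hc.1)]
      simp [h₂]
  · split_ifs
    all_goals simp_all

theorem c_mul_b_eq_nbc (k j : ℤ) :
    M.c j * M.b k
      = -M.nbc k j + ((if k + j = 0 then 1 else 0) * (if k ≤ 0 then 1 else 0) : ℂ) • 1 := by
  rw [M.c_mul_b, b_mul_c_eq_nbc]
  by_cases h₁ : k + j = 0
  · by_cases h₂ : 1 ≤ k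
    · have h₃ : ¬ k ≤ 0 := by omega
      simp [h₁, h₂, h₃]
    · have h₃ : k ≤ 0 := by omega
      simp [h₁, h₂, h₃]
      abel
  · simp [h₁]

theorem nbc_comm_b (k j n : ℤ) :
    M.nbc k j * M.b n - M.b n * M.nbc k j = if j + n = 0 then M.b k else 0 := by
  have h₁ : M.nbc k j
      = M.b k * M.c j - ((if k + j = 0 then 1 else 0) * (if 1 ≤ k then 1 else 0) : ℂ) • 1 :=
    eq_sub_of_add_eq (M.b_mul_c_eq_nbc k j).symm
  have h₂ : M.b k * M.c j * M.b n - M.b n * (M.b k * M.c j) = if j + n = 0 then M.b k else 0 := by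
    rw [mul_assoc, c_mul_b, ← mul_assoc, M.b_mul_b_comm n k, mul_sub, add_comm n j]
    split_ifs <;> simp [mul_assoc]
  rw [h₁, ← h₂]
  simp only [sub_mul, mul_sub, smul_mul_assoc, mul_smul_comm, one_mul, mul_one]
  abel

theorem nbc_comm_c (k j n : ℤ) :
    M.nbc k j * M.c n - M.c n * M.nbc k j = if k + n = 0 then -M.c j else 0 := by
  have h₁ : M.nbc k j
      = M.b k * M.c j - ((if k + j = 0 then 1 else 0) * (if 1 ≤ k then 1 else 0) : ℂ) • 1 :=
    eq_sub_of_add_eq (M.b_mul_c_eq_nbc k j).symm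
  have h₂ : M.b k * M.c j * M.c n - M.c n * (M.b k * M.c j) = if k + n = 0 then -M.c j else 0 := by
    rw [← mul_assoc (M.c n), c_mul_b, mul_assoc, M.c_mul_c_comm j n, sub_mul]
    split_ifs <;> simp [mul_assoc, sub_eq_add_neg]
  rw [h₁, ← h₂]
  simp only [sub_mul, mul_sub, smul_mul_assoc, mul_smul_comm, one_mul, mul_one]
  abel

theorem nbc_parity (k j : ℤ) : M.parity * M.nbc k j = M.nbc k j * M.parity := by
  have h : ∀ X Y : Module.End ℂ F, M.parity * X = -(X * M.parity) →
      M.parity * Y = -(Y * M.parity) → M.parity * (X * Y) = X * Y * M.parity := by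
    intro X Y hX hY
    rw [← mul_assoc, hX, neg_mul, mul_assoc, hY, mul_neg, neg_neg, mul_assoc]
  unfold nbc
  split_ifs
  · rw [mul_neg, neg_mul, h _ _ (M.parity_c _) (M.parity_b _)]
  · exact h _ _ (M.parity_b _) (M.parity_c _)

theorem nbc_vacuum {k j : ℤ} (h : 1 ≤ k ∨ 0 ≤ j) : M.nbc k j M.Ω = 0 := by
  unfold nbc
  split_ifs with h₁
  · simp [M.b_vacuum k h₁.1]
  · simp [M.c_vacuum j (by omega)]

theorem vac_nbc {k j : ℤ} (h : k ≤ 0 ∨ j ≤ -1) (x : F) : M.vac (M.nbc k j x) = 0 := by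
  unfold nbc
  split_ifs with h₁
  · simp [M.vac_c j h₁.2]
  · simp [M.vac_b k (by omega)]

theorem vac_nbc_vacuum (k j : ℤ) : M.vac (M.nbc k j M.Ω) = 0 := by
  by_cases h : 1 ≤ k
  · rw [M.nbc_vacuum (Or.inl h), map_zero]
  · exact M.vac_nbc (Or.inl (by omega)) _

theorem vac_nbc_mul_nbc (k j k' j' : ℤ) :
    M.vac (M.nbc k j (M.nbc k' j' M.Ω))
      = if 1 ≤ k ∧ 0 ≤ j ∧ j + k' = 0 ∧ k + j' = 0 then 1 else 0 := by
  by_cases h : 1 ≤ k ∧ 0 ≤ j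
  · have h₁ : M.nbc k j (M.nbc k' j' M.Ω)
        = (M.nbc k j * M.nbc k' j' - M.nbc k' j' * M.nbc k j) M.Ω := by
      simp [M.nbc_vacuum (Or.inl h.1)]
    have h₂ : M.nbc k' j'
        = M.b k' * M.c j' - ((if k' + j' = 0 then 1 else 0) * (if 1 ≤ k' then 1 else 0) : ℂ) • 1 :=
      eq_sub_of_add_eq (M.b_mul_c_eq_nbc k' j').symm
    have h₃ : M.nbc k j * M.nbc k' j' - M.nbc k' j' * M.nbc k j
        = (M.nbc k j * M.b k' - M.b k' * M.nbc k j) * M.c j'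
          + M.b k' * (M.nbc k j * M.c j' - M.c j' * M.nbc k j) := by
      rw [h₂]
      simp only [sub_mul, mul_sub, smul_mul_assoc, mul_smul_comm, one_mul, mul_one, mul_assoc]
      abel
    rw [h₁, h₃, nbc_comm_b, nbc_comm_c]
    have h₄ : M.vac ((M.b k * M.c j') M.Ω) = if k + j' = 0 then 1 else 0 := by
      rw [b_mul_c_eq_nbc, LinearMap.add_apply, map_add, vac_nbc_vacuum]
      rw [if_pos h.1]
      split_ifs <;> simp [M.vac_vacuum]
    have h₅ : (M.b k' * if k + j' = 0 then -M.c j else 0) M.Ω = 0 := by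
      split_ifs <;> simp [M.c_vacuum j h.2]
    rw [LinearMap.add_apply, h₅, add_zero]
    by_cases h₆ : j + k' = 0
    · rw [if_pos h₆, h₄]
      simp [h.1, h.2, h₆]
    · simp [h₆]
  · rw [M.vac_nbc (by omega), if_neg (by tauto)]

/-! ### Bilinear modes -/

theorem exists_nbc_eq_zero (x : F) :
    ∃ N : ℤ, 0 ≤ N ∧ ∀ k j, k + j ≠ 0 → (N < k ∨ N < j) → M.nbc k j x = 0 := by
  obtain ⟨N, hN⟩ := M.eventually_zero x
  refine ⟨max N 0, le_max_right _ _, fun k j hkj h => ?_⟩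
  rcases h with h | h
  · have h₁ := M.c_mul_b_eq_nbc k j
    rw [if_neg hkj, zero_mul, zero_smul, add_zero] at h₁
    rw [← neg_neg (M.nbc k j), ← h₁]
    simp [(hN k (lt_of_le_of_lt (le_max_left _ _) h)).1]
  · have h₁ := M.b_mul_c_eq_nbc k j
    rw [if_neg hkj, zero_mul, zero_smul, add_zero] at h₁
    rw [← h₁]
    simp [(hN j (lt_of_le_of_lt (le_max_left _ _) h)).2]

theorem exists_nbc_eq_zero' (x : F) :
    ∃ N : ℤ, 0 ≤ N ∧ ∀ k j, (N < k ∧ j ≤ -1 ∨ N < j) → M.nbc k j x = 0 := by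
  obtain ⟨N, hN⟩ := M.eventually_zero x
  refine ⟨max N 0, le_max_right _ _, fun k j h => ?_⟩
  unfold nbc
  split_ifs with h'
  · simp [(hN k (by omega)).1]
  · simp [(hN j (by omega)).2]

theorem locFin_nbc (f : ℤ → ℂ) (m : ℤ) : LocFin fun k => f k • M.nbc k (m - k) := by
  apply locFin_of_eventually
  · intro x
    obtain ⟨N, hN₀, hN⟩ := M.exists_nbc_eq_zero' x
    refine ⟨max N m, fun k hk => ?_⟩
    rw [LinearMap.smul_apply, hN k (m - k) (by omega), smul_zero]
  · intro x
    obtain ⟨N, hN₀, hN⟩ := M.exists_nbc_eq_zero' x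
    refine ⟨m - N, fun k hk => ?_⟩
    rw [LinearMap.smul_apply, hN k (m - k) (by omega), smul_zero]

/-- The bilinear mode `Σ_k f(k) :b(k)c(m-k):`. -/
def quad (f : ℤ → ℂ) (m : ℤ) : Module.End ℂ F := lsum _ (M.locFin_nbc f m)

theorem hasLSum_quad (f : ℤ → ℂ) (m : ℤ) :
    HasLSum (fun k => f k • M.nbc k (m - k)) (M.quad f m) := hasLSum_lsum _

theorem quad_comm_b (f : ℤ → ℂ) (m n : ℤ) :
    M.quad f m * M.b n - M.b n * M.quad f m = f (m + n) • M.b (m + n) := by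
  have h := M.hasLSum_quad f m
  have h₁ := (h.mul_right (M.b n)).sub (h.mul_left (M.b n))
  have h₂ : ∀ k, f k • M.nbc k (m - k) * M.b n - M.b n * f k • M.nbc k (m - k)
      = if k = m + n then f k • M.b k else 0 := fun k => by
    rw [smul_mul_assoc, mul_smul_comm, ← smul_sub, nbc_comm_b]
    by_cases hk : k = m + n
    · rw [if_pos (by omega), if_pos hk]
    · rw [if_neg (by omega), if_neg hk, smul_zero]
  have h₃ := hasLSum_single (F := F) (T := fun k => if k = m + n then f k • M.b k else 0) (m + n)
    fun k hk => if_neg hk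
  rw [if_pos rfl] at h₃
  exact h₁.unique (h₃.congr h₂)

theorem quad_comm_c (f : ℤ → ℂ) (m n : ℤ) :
    M.quad f m * M.c n - M.c n * M.quad f m = (-f (-n)) • M.c (m + n) := by
  have h := M.hasLSum_quad f m
  have h₁ := (h.mul_right (M.c n)).sub (h.mul_left (M.c n))
  have h₂ : ∀ k, f k • M.nbc k (m - k) * M.c n - M.c n * f k • M.nbc k (m - k)
      = if k = -n then (-f k) • M.c (m - k) else 0 := fun k => by
    rw [smul_mul_assoc, mul_smul_comm, ← smul_sub, nbc_comm_c]
    by_cases hk : k = -n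
    · rw [if_pos (by omega), if_pos hk, neg_smul, smul_neg]
    · rw [if_neg (by omega), if_neg hk, smul_zero]
  have h₃ := hasLSum_single (F := F) (T := fun k => if k = -n then (-f k) • M.c (m - k) else 0) (-n)
    fun k hk => if_neg hk
  rw [if_pos rfl, sub_neg_eq_add] at h₃
  exact h₁.unique (h₃.congr h₂)

theorem quad_parity (f : ℤ → ℂ) (m : ℤ) :
    M.parity * M.quad f m = M.quad f m * M.parity :=
  ((M.hasLSum_quad f m).mul_left M.parity).unique
    (((M.hasLSum_quad f m).mul_right M.parity).congr fun k => by
      rw [mul_smul_comm, smul_mul_assoc, nbc_parity])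

theorem vac_quad_vacuum (f : ℤ → ℂ) (m : ℤ) : M.vac (M.quad f m M.Ω) = 0 := by
  rw [(M.hasLSum_quad f m).apply_dual]
  simp [vac_nbc_vacuum]

theorem vac_quad (f : ℤ → ℂ) {m : ℤ} (hm : m ≤ 0) (x : F) : M.vac (M.quad f m x) = 0 := by
  rw [(M.hasLSum_quad f m).apply_dual]
  refine (finsum_congr fun k => ?_).trans finsum_zero
  rw [LinearMap.smul_apply, map_smul, M.vac_nbc (by omega), smul_zero]

theorem exists_quad_eq_zero (f : ℤ → ℂ) (x : F) : ∃ N : ℤ, ∀ m > N, M.quad f m x = 0 := by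
  obtain ⟨N, hN₀, hN⟩ := M.exists_nbc_eq_zero x
  refine ⟨2 * N, fun m hm => ?_⟩
  rw [← (M.hasLSum_quad f m).sum_eq]
  refine (finsum_congr fun k => ?_).trans finsum_zero
  rw [LinearMap.smul_apply, hN k (m - k) (by omega) (by omega), smul_zero]

theorem vac_quad_mul_quad (f g : ℤ → ℂ) (m n : ℤ) :
    M.vac (M.quad f m (M.quad g n M.Ω))
      = if m + n = 0 then ∑ᶠ k, if 1 ≤ k ∧ k ≤ m then f k * g (k - m) else 0 else 0 := by
  have h₁ : ∀ k, M.vac ((f k • M.nbc k (m - k)) (M.quad g n M.Ω))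
      = if m + n = 0 then (if 1 ≤ k ∧ k ≤ m then f k * g (k - m) else 0) else 0 := by
    intro k
    rw [LinearMap.smul_apply, map_smul, ← Module.End.mul_apply,
      ((M.hasLSum_quad g n).mul_left (M.nbc k (m - k))).apply_dual, finsum_eq_single _ (k - m)]
    · rw [mul_smul_comm, LinearMap.smul_apply, map_smul, Module.End.mul_apply, vac_nbc_mul_nbc]
      by_cases hmn : m + n = 0
      · by_cases hk : 1 ≤ k ∧ k ≤ m
        · rw [if_pos ⟨hk.1, by omega, by omega, by omega⟩, if_pos hmn, if_pos hk]
          simp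
        · rw [if_neg (by omega), if_pos hmn, if_neg hk]
          simp
      · rw [if_neg (by omega), if_neg hmn]
        simp
    · intro l hl
      rw [mul_smul_comm, LinearMap.smul_apply, map_smul, Module.End.mul_apply, vac_nbc_mul_nbc,
        if_neg (by omega), smul_zero]
  rw [(M.hasLSum_quad f m).apply_dual, finsum_congr h₁]
  split_ifs
  · rfl
  · exact finsum_zero

theorem quad_comm_quad (f g : ℤ → ℂ) (m n : ℤ) :
    M.quad f m * M.quad g n - M.quad g n * M.quad f m
      = M.quad (fun k => f k * g (k - m) - g k * f (k - n)) (m + n)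
        + (if m + n = 0 then ∑ᶠ k, f k * g (k - m) * signedInd 0 m k else 0) • 1 := by
  set h : ℤ → ℂ := fun k => f k * g (k - m) - g k * f (k - n) with hh
  set s : ℂ := if m + n = 0 then ∑ᶠ k, f k * g (k - m) * signedInd 0 m k else 0 with hs
  rw [← sub_eq_zero]
  have key : ∀ (A B C X : Module.End ℂ F) (s : ℂ),
      A * B * X - B * A * X - X * (A * B) + X * (B * A) = C * X - X * C →
      (A * B - B * A - (C + s • 1)) * X = (1 : ℂ) • (X * (A * B - B * A - (C + s • 1))) := by
    intro A B C X s hX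
    rw [one_smul, ← sub_eq_zero]
    have : (A * B - B * A - (C + s • 1)) * X - X * (A * B - B * A - (C + s • 1))
        = (A * B * X - B * A * X - X * (A * B) + X * (B * A)) - (C * X - X * C) := by
      simp only [sub_mul, mul_sub, add_mul, mul_add, smul_mul_assoc, mul_smul_comm, one_mul,
        mul_one]
      abel
    rw [this, hX, sub_self]
  have jac : ∀ A B X : Module.End ℂ F,
      A * B * X - B * A * X - X * (A * B) + X * (B * A)
        = A * (B * X - X * B) + (A * X - X * A) * B
          - (B * (A * X - X * A) + (B * X - X * B) * A) := by
    intro A B X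
    noncomm_ring
  have comb : ∀ (A B Y Z : Module.End ℂ F) (u v p q : ℂ),
      A * Y - Y * A = p • Z → ∀ W, B * W - W * B = q • Z →
      A * (u • Y) + v • W * B - (B * (v • W) + u • Y * A) = (u * p - v * q) • Z := by
    intro A B Y Z u v p q h₁ W h₂
    have : A * (u • Y) + v • W * B - (B * (v • W) + u • Y * A)
        = u • (A * Y - Y * A) - v • (B * W - W * B) := by
      simp only [mul_smul_comm, smul_mul_assoc, smul_sub]
      abel
    rw [this, h₁, h₂, smul_smul, smul_smul, sub_smul]
  apply M.eq_zero _ 1 one_ne_zero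
  · intro l
    apply key
    rw [jac, quad_comm_b, quad_comm_b, quad_comm_b]
    rw [comb _ _ _ (M.b (m + n + l)) _ _ _ _ (by rw [quad_comm_b, ← add_assoc]) _
      (by rw [quad_comm_b, ← add_assoc, add_comm n m])]
    congr 1
    rw [hh]
    ring_nf
  · intro l
    apply key
    rw [jac, quad_comm_c, quad_comm_c, quad_comm_c]
    rw [comb _ _ _ (M.c (m + n + l)) _ _ _ _ (by rw [quad_comm_c, ← add_assoc]) _
      (by rw [quad_comm_c, ← add_assoc, add_comm n m])]
    congr 1
    rw [hh]
    ring_nf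
  · simp only [LinearMap.sub_apply, LinearMap.add_apply, Module.End.mul_apply, map_sub, map_add,
      LinearMap.smul_apply, Module.End.one_apply, map_smul, vac_quad_vacuum, vac_quad_mul_quad,
      M.vac_vacuum, zero_add, smul_eq_mul, mul_one]
    rw [hs, add_comm n m]
    split_ifs with hmn
    · obtain rfl : n = -m := by omega
      rw [← finsum_comp_equiv (Equiv.subRight m)
        (f := fun k => if 1 ≤ k ∧ k ≤ -m then g k * f (k - -m) else 0), sub_eq_zero,
        ← finsum_sub_distrib]
      · refine finsum_congr fun k => ?_
        simp only [Equiv.subRight_apply, sub_neg_eq_add, sub_add_cancel, signedInd]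
        by_cases h₁ : k ≤ 0 <;> by_cases h₂ : k ≤ m
        · rw [if_neg (by omega), if_neg (by omega)]
          simp [h₁, h₂]
        · rw [if_neg (by omega), if_pos (by omega)]
          simp [h₁, h₂, mul_comm]
        · rw [if_pos (by omega), if_neg (by omega)]
          simp [h₁, h₂]
        · rw [if_neg (by omega), if_neg (by omega)]
          simp [h₁, h₂]
      · refine (Set.finite_Icc 1 m).subset fun k hk => ?_
        by_contra hc
        exact hk (if_neg fun h => hc (Set.mem_Icc.mpr h))
      · refine (Set.finite_Icc (m + 1) 0).subset fun k hk => ?_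
        by_contra hc
        refine hk (if_neg fun hc' => hc ?_)
        rw [Equiv.subRight_apply] at hc'
        exact ⟨by omega, by omega⟩
    · simp

/-! ### The Virasoro modes and their normally ordered square -/

/-- The Virasoro modes. -/
def L (m : ℤ) : Module.End ℂ F := M.quad (fun k => -k) m

theorem L_comm_b (m n : ℤ) :
    M.L m * M.b n - M.b n * M.L m = (-(m + n) : ℂ) • M.b (m + n) := by
  rw [L, quad_comm_b]
  push_cast
  rfl

theorem L_comm_c (m n : ℤ) :
    M.L m * M.c n - M.c n * M.L m = (-n : ℂ) • M.c (m + n) := by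
  rw [L, quad_comm_c]
  push_cast
  rw [neg_neg]

theorem L_vacuum {m : ℤ} (hm : -1 ≤ m) : M.L m M.Ω = 0 := by
  rw [L, ← (M.hasLSum_quad _ m).sum_eq]
  refine (finsum_congr fun k => ?_).trans finsum_zero
  rw [LinearMap.smul_apply]
  by_cases hk : k = 0
  · simp [hk]
  · rw [M.nbc_vacuum (by omega), smul_zero]

/-- The summands of the modes of the normally ordered square of the Virasoro field. -/
def sqTerm (m k : ℤ) : Module.End ℂ F :=
  if k ≤ -2 then M.L k * M.L (m - k) else M.L (m - k) * M.L k

theorem locFin_sqTerm (m : ℤ) : LocFin (M.sqTerm m) := by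
  apply locFin_of_eventually
  · intro x
    obtain ⟨N, hN⟩ := M.exists_quad_eq_zero (fun k => -k) x
    refine ⟨max N 0, fun k hk => ?_⟩
    rw [sqTerm, if_neg (by omega), Module.End.mul_apply, L, L, hN k (by omega), map_zero]
  · intro x
    obtain ⟨N, hN⟩ := M.exists_quad_eq_zero (fun k => -k) x
    refine ⟨min (m - N) (-2), fun k hk => ?_⟩
    rw [sqTerm, if_pos (by omega), Module.End.mul_apply, L, L, hN (m - k) (by omega), map_zero]

theorem sqTerm_parity (m k : ℤ) : M.parity * M.sqTerm m k = M.sqTerm m k * M.parity := by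
  have h : ∀ p q, M.parity * (M.L p * M.L q) = M.L p * M.L q * M.parity := fun p q => by
    rw [← mul_assoc, L, L, quad_parity, mul_assoc, quad_parity, mul_assoc]
  unfold sqTerm
  split_ifs <;> exact h _ _

theorem vac_sqTerm (m k : ℤ) : M.vac (M.sqTerm m k M.Ω) = 0 := by
  unfold sqTerm
  split_ifs with h
  · exact M.vac_quad _ (by omega) _
  · rw [Module.End.mul_apply, M.L_vacuum (by omega), map_zero, map_zero]

/-- The double bracket `{[A, u], v}`. -/
def dbl (A u v : Module.End ℂ F) : Module.End ℂ F := (A * u - u * A) * v + v * (A * u - u * A)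

theorem dbl_sub (A B u v : Module.End ℂ F) : dbl (A - B) u v = dbl A u v - dbl B u v := by
  unfold dbl
  noncomm_ring

theorem dbl_mul (A B u v : Module.End ℂ F) :
    dbl (A * B) u v
      = A * ((B * u - u * B) * v + v * (B * u - u * B)) - (A * v - v * A) * (B * u - u * B)
        + (A * u - u * A) * (B * v - v * B)
        + ((A * u - u * A) * v + v * (A * u - u * A)) * B := by
  unfold dbl
  noncomm_ring

theorem _root_.BCFock.HasLSum.dbl {T : ℤ → Module.End ℂ F} {A : Module.End ℂ F} (h : HasLSum T A)
    (u v : Module.End ℂ F) : HasLSum (fun k => dbl (T k) u v) (dbl A u v) :=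
  (((h.mul_right u).sub (h.mul_left u)).mul_right v).add
    (((h.mul_right u).sub (h.mul_left u)).mul_left v)

theorem hasLSum_zero_of_anticomm {X : ℤ → Module.End ℂ F} (hX : ∀ m n, X m * X n = -(X n * X m))
    (hX₀ : ∀ x, ∃ N : ℤ, ∀ k > N, X k x = 0) (n : ℤ) {g : ℤ → ℂ} (hg : ∀ k, g (n - k) = g k) :
    HasLSum (fun k => g k • (X (n - k) * X k)) 0 := by
  apply hasLSum_zero_of_antisymm _ (Equiv.subLeft n)
  · intro k
    rw [Equiv.subLeft_apply, sub_sub_cancel, hg, hX, smul_neg]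
  · apply locFin_of_eventually
    · intro x
      obtain ⟨N, hN⟩ := hX₀ x
      refine ⟨N, fun k hk => ?_⟩
      rw [LinearMap.smul_apply, Module.End.mul_apply, hN k hk, map_zero, smul_zero]
    · intro x
      obtain ⟨N, hN⟩ := hX₀ x
      refine ⟨n - N, fun k hk => ?_⟩
      rw [hX, LinearMap.smul_apply, LinearMap.neg_apply, Module.End.mul_apply,
        hN (n - k) (by omega), map_zero, neg_zero, smul_zero]

theorem dbl_sqTerm_of_symm {m : ℤ} {u v : Module.End ℂ F} {G : ℤ → Module.End ℂ F}
    (hG : ∀ p q, p + q = m → dbl (M.L p * M.L q) u v = G q + G p) (k : ℤ) :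
    dbl (M.sqTerm m k) u v = G k + G (m - k) := by
  unfold sqTerm
  split_ifs
  · rw [hG k (m - k) (by ring), add_comm]
  · exact hG (m - k) k (by ring)

theorem hasLSum_dbl_sqTerm_b_b (m j i : ℤ) :
    HasLSum (fun k => dbl (M.sqTerm m k) (M.b j) (M.b i)) 0 := by
  have h₀ := (hasLSum_zero_of_anticomm M.b_mul_b_comm
    (fun x => (M.eventually_zero x).imp fun N hN k hk => (hN k hk).1) (i + m + j)
    (g := fun k => -((k : ℂ) * (i + m + j - k))) fun k => by push_cast; ring).comp_equiv
    (Equiv.addLeft j)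
  have h₁ := h₀.add (h₀.comp_equiv (Equiv.subLeft m))
  rw [add_zero] at h₁
  refine h₁.congr (M.dbl_sqTerm_of_symm (G := fun k => _) fun p q hpq => ?_)
  obtain rfl : m = p + q := hpq.symm
  have hz : ∀ (r : ℂ) (k : ℤ), r • M.b k * M.b i + M.b i * r • M.b k = 0 := fun r k => by
    rw [smul_mul_assoc, mul_smul_comm, ← smul_add, M.b_mul_b, smul_zero]
  rw [dbl_mul, L_comm_b, L_comm_b, L_comm_b, L_comm_b, hz, hz, mul_zero, zero_mul, zero_sub,
    add_zero]
  simp only [Equiv.coe_addLeft]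
  rw [show i + (p + q) + j - (j + q) = p + i by ring,
    show i + (p + q) + j - (j + p) = q + i by ring,
    M.b_mul_b_comm (q + i), add_comm j q, add_comm j p, smul_mul_smul_comm, smul_mul_smul_comm,
    smul_neg, ← neg_smul, ← neg_smul]
  push_cast
  congr 2 <;> ring

theorem hasLSum_dbl_sqTerm_c_c (m j i : ℤ) :
    HasLSum (fun k => dbl (M.sqTerm m k) (M.c j) (M.c i)) 0 := by
  have h₀ := (hasLSum_zero_of_anticomm M.c_mul_c_comm
    (fun x => (M.eventually_zero x).imp fun N hN k hk => (hN k hk).2) (i + m + j)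
    (g := fun _ => -((i : ℂ) * j)) fun k => rfl).comp_equiv (Equiv.addLeft j)
  have h₁ := h₀.add (h₀.comp_equiv (Equiv.subLeft m))
  rw [add_zero] at h₁
  refine h₁.congr (M.dbl_sqTerm_of_symm (G := fun k => _) fun p q hpq => ?_)
  obtain rfl : m = p + q := hpq.symm
  have hz : ∀ (r : ℂ) (k : ℤ), r • M.c k * M.c i + M.c i * r • M.c k = 0 := fun r k => by
    rw [smul_mul_assoc, mul_smul_comm, ← smul_add, M.c_mul_c, smul_zero]
  rw [dbl_mul, L_comm_c, L_comm_c, L_comm_c, L_comm_c, hz, hz, mul_zero, zero_mul, zero_sub,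
    add_zero]
  simp only [Equiv.coe_addLeft]
  rw [show i + (p + q) + j - (j + q) = p + i by ring,
    show i + (p + q) + j - (j + p) = q + i by ring,
    M.c_mul_c_comm (q + i), add_comm j q, add_comm j p, smul_mul_smul_comm, smul_mul_smul_comm,
    smul_neg, ← neg_smul, ← neg_smul]
  congr 2 <;> ring

theorem dbl_L_mul_L_b_c (p q j i : ℤ) :
    dbl (M.L p * M.L q) (M.b j) (M.c i)
      = ((i : ℂ) * if q + j + i = 0 then 1 else 0) • M.L p
        + ((i : ℂ) * (q + j)) • M.nbc (q + j) (p + i)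
        + (((i : ℂ) * if p + j + i = 0 then 1 else 0) • M.L q
          + ((i : ℂ) * (p + j)) • M.nbc (p + j) (q + i))
        + ((i : ℂ) * (if p + q + j + i = 0 then 1 else 0)
          * (-((q + j) * if q + j ≤ 0 then 1 else 0) + (p + j) * if 1 ≤ p + j then 1 else 0)) •
            1 := by
  have hd : ∀ k : ℤ, (-(k + j) : ℂ) • M.b (k + j) * M.c i + M.c i * (-(k + j) : ℂ) • M.b (k + j)
      = ((i : ℂ) * if k + j + i = 0 then 1 else 0) • 1 := fun k => by
    rw [smul_mul_assoc, mul_smul_comm, ← smul_add, M.b_mul_c]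
    split_ifs with h
    · rw [mul_one]
      congr 1
      have : (k : ℂ) + j + i = 0 := by exact_mod_cast h
      linear_combination -this
    · rw [mul_zero, zero_smul, smul_zero]
  rw [dbl_mul, L_comm_b, L_comm_b, L_comm_c, L_comm_c, hd, hd, smul_mul_smul_comm,
    smul_mul_smul_comm, c_mul_b_eq_nbc, b_mul_c_eq_nbc, mul_smul_comm, mul_one, smul_mul_assoc,
    one_mul, show q + j + (p + i) = p + q + j + i by ring,
    show p + j + (q + i) = p + q + j + i by ring]
  simp only [smul_add, smul_neg, smul_smul]
  module

theorem finsum_signedInd_sqTerm (m j : ℤ) :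
    ∑ᶠ k : ℤ, (((j : ℂ) + k) * signedInd (-j) (-2) k
        + ((m : ℂ) + j - k) * signedInd (-2) (m + j - 1) k)
      = ((j - 1) * (j - 2) + (m + j + 1) * (m + j + 2)) / 2 := by
  rw [finsum_add_distrib (signedInd_support _ _ _) (signedInd_support _ _ _),
    finsum_signedInd (fun k => (j : ℂ) * k + k * (k + 1) / 2) _ fun k => by push_cast; ring,
    finsum_signedInd (fun k => ((m : ℂ) + j) * k - k * (k + 1) / 2) _ fun k => by push_cast; ring]
  push_cast
  ring

theorem hasLSum_dbl_sqTerm_b_c (m j i : ℤ) :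
    HasLSum (fun k => dbl (M.sqTerm m k) (M.b j) (M.c i))
      (((i : ℂ) * (if m + j + i = 0 then 1 else 0)
        * (((j - 1) * (j - 2) + (m + j + 1) * (m + j + 2)) / 2)) • 1) := by
  have h₁ : HasLSum (fun k => ((i : ℂ) * if k + j + i = 0 then 1 else 0) • M.L (m - k))
      ((i : ℂ) • M.L (m + j + i)) := by
    have h := hasLSum_single (-j - i)
      (T := fun k => ((i : ℂ) * if k + j + i = 0 then 1 else 0) • M.L (m - k)) fun k hk => by
        rw [if_neg (by omega), mul_zero, zero_smul]
    rwa [if_pos (by ring), mul_one, show m - (-j - i) = m + j + i by ring] at h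
  have h₂ : HasLSum (fun k => ((i : ℂ) * (k + j)) • M.nbc (k + j) (m - k + i))
      ((-i : ℂ) • M.L (m + j + i)) :=
    (((M.hasLSum_quad (fun k => -k) (m + j + i)).comp_equiv (Equiv.addRight j)).smul (-i)).congr
      fun k => by
        rw [Equiv.coe_addRight, smul_smul, show m + j + i - (k + j) = m - k + i by ring]
        push_cast
        congr 1
        ring
  have h₃ := h₁.add h₂
  rw [← add_smul, add_neg_cancel, zero_smul] at h₃
  have h₄ := h₃.add (h₃.comp_equiv (Equiv.subLeft m))
  rw [add_zero] at h₄
  have h₅ := (hasLSum_smul_one (F := F) (((signedInd_support (-j) (-2) fun k => (j : ℂ) + k).union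
    (signedInd_support (-2) (m + j - 1) fun k => (m : ℂ) + j - k)).subset
      (Function.support_add _ _))).smul ((i : ℂ) * if m + j + i = 0 then 1 else 0)
  have h₆ := h₄.add h₅
  rw [zero_add, smul_smul] at h₆
  erw [finsum_signedInd_sqTerm] at h₆
  refine h₆.congr fun k => ?_
  simp only [Equiv.subLeft_apply, smul_smul, sub_sub_cancel]
  have hi : ∀ a b : ℤ, (if a ≤ b then (1 : ℂ) else 0) = 1 - if b + 1 ≤ a then 1 else 0 := by
    intro a b
    by_cases h : a ≤ b
    · rw [if_pos h, if_neg (by omega), sub_zero]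
    · rw [if_neg h, if_pos (by omega), sub_self]
  by_cases hk : k ≤ -2
  · rw [sqTerm, if_pos hk, dbl_L_mul_L_b_c, show k + (m - k) = m by ring]
    have hs : -(((m - k : ℤ) + (j : ℂ)) * if m - k + j ≤ 0 then 1 else 0)
        + (k + j) * (if 1 ≤ k + j then 1 else 0)
        = ((j : ℂ) + k) * signedInd (-j) (-2) k
          + ((m : ℂ) + j - k) * signedInd (-2) (m + j - 1) k := by
      have h₁ : (1 ≤ k + j) ↔ (-j + 1 ≤ k) := by omega
      have h₂ : (m - k + j ≤ 0) ↔ (m + j - 1 + 1 ≤ k) := by omega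
      simp only [signedInd, h₁, h₂, if_pos hk, hi k (-j), hi k (m + j - 1)]
      push_cast
      ring
    rw [hs, add_comm]
    push_cast
    abel
  · rw [sqTerm, if_neg hk, dbl_L_mul_L_b_c, show m - k + k = m by ring]
    have hs : -(((k : ℂ) + j) * if k + j ≤ 0 then 1 else 0)
        + ((m - k : ℤ) + j) * (if 1 ≤ m - k + j then 1 else 0)
        = ((j : ℂ) + k) * signedInd (-j) (-2) k
          + ((m : ℂ) + j - k) * signedInd (-2) (m + j - 1) k := by
      have h₁ : (k + j ≤ 0) ↔ (k ≤ -j) := by omega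
      have h₂ : (1 ≤ m - k + j) ↔ (k ≤ m + j - 1) := by omega
      simp only [signedInd, h₁, h₂, if_neg hk]
      push_cast
      ring
    rw [hs]

/-- The function `q` such that the modes of the normally ordered square of the Virasoro field are
`Σ_k q(k) :b(k)c(m-k):`. -/
def sqCoeff (m k : ℤ) : ℂ :=
  -k * (((k - m - 1) * (k - m - 2) + (k + 1) * (k + 2)) / 2)

theorem dbl_quad_b_b (f : ℤ → ℂ) (m j i : ℤ) : dbl (M.quad f m) (M.b j) (M.b i) = 0 := by
  rw [dbl, quad_comm_b, smul_mul_assoc, mul_smul_comm, ← smul_add, M.b_mul_b, smul_zero]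

theorem dbl_quad_c_c (f : ℤ → ℂ) (m j i : ℤ) : dbl (M.quad f m) (M.c j) (M.c i) = 0 := by
  rw [dbl, quad_comm_c, smul_mul_assoc, mul_smul_comm, ← smul_add, M.c_mul_c, smul_zero]

theorem dbl_quad_b_c (f : ℤ → ℂ) (m j i : ℤ) :
    dbl (M.quad f m) (M.b j) (M.c i) = (f (m + j) * if m + j + i = 0 then 1 else 0) • 1 := by
  rw [dbl, quad_comm_b, smul_mul_assoc, mul_smul_comm, ← smul_add, M.b_mul_c]
  split_ifs <;> simp

theorem eq_zero_of_dbl {D : Module.End ℂ F} (hp : M.parity * D = D * M.parity)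
    (hbb : ∀ j i, dbl D (M.b j) (M.b i) = 0) (hbc : ∀ j i, dbl D (M.b j) (M.c i) = 0)
    (hcc : ∀ j i, dbl D (M.c j) (M.c i) = 0) (h₀ : M.vac (D M.Ω) = 0) : D = 0 := by
  have hpar : ∀ u, M.parity * u = -(u * M.parity) →
      M.parity * (D * u - u * D) = -((D * u - u * D) * M.parity) := by
    intro u hu
    rw [mul_sub, ← mul_assoc, ← mul_assoc, hp, hu, mul_assoc, hu, neg_mul, mul_assoc u, hp]
    noncomm_ring
  have hneg : ∀ X v : Module.End ℂ F, X * v + v * X = 0 → X * v = (-1 : ℂ) • (v * X) := by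
    intro X v h
    rw [neg_one_smul]
    exact eq_neg_of_add_eq_zero_left h
  have hb : ∀ j, D * M.b j - M.b j * D = 0 := fun j =>
    M.eq_zero _ (-1) (by norm_num) (fun i => hneg _ _ (hbb j i)) (fun i => hneg _ _ (hbc j i))
      (M.vac_of_parity (hpar _ (M.parity_b j)))
  have hc : ∀ j, D * M.c j - M.c j * D = 0 := fun j => by
    refine M.eq_zero _ (-1) (by norm_num) (fun i => hneg _ _ ?_) (fun i => hneg _ _ (hcc j i))
      (M.vac_of_parity (hpar _ (M.parity_c j)))
    have h₁ : (D * M.c j - M.c j * D) * M.b i + M.b i * (D * M.c j - M.c j * D)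
        = D * (M.b i * M.c j + M.c j * M.b i) - (M.b i * M.c j + M.c j * M.b i) * D
          - (M.c j * (D * M.b i - M.b i * D) + (D * M.b i - M.b i * D) * M.c j) := by
      noncomm_ring
    rw [h₁, hb, M.b_mul_c]
    split_ifs <;> simp
  exact M.eq_zero D 1 one_ne_zero (fun n => by rw [one_smul]; exact sub_eq_zero.mp (hb n))
    (fun n => by rw [one_smul]; exact sub_eq_zero.mp (hc n)) h₀

theorem hasLSum_sqTerm (m : ℤ) : HasLSum (M.sqTerm m) (M.quad (sqCoeff m) m) := by
  have h := hasLSum_lsum (M.locFin_sqTerm m)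
  have hD : lsum _ (M.locFin_sqTerm m) - M.quad (sqCoeff m) m = 0 := by
    apply M.eq_zero_of_dbl
    · have hS := (h.mul_left M.parity).unique
        ((h.mul_right M.parity).congr fun k => M.sqTerm_parity m k)
      rw [mul_sub, hS, quad_parity, sub_mul]
    · intro j i
      rw [dbl_sub, dbl_quad_b_b, (h.dbl _ _).unique (M.hasLSum_dbl_sqTerm_b_b m j i), sub_zero]
    · intro j i
      rw [dbl_sub, dbl_quad_b_c, (h.dbl _ _).unique (M.hasLSum_dbl_sqTerm_b_c m j i), ← sub_smul]
      split_ifs with hi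
      · obtain rfl : i = -(m + j) := by omega
        rw [sqCoeff]
        push_cast
        convert zero_smul ℂ _
        ring
      · rw [mul_zero, mul_zero, zero_mul, sub_zero, zero_smul]
    · intro j i
      rw [dbl_sub, dbl_quad_c_c, (h.dbl _ _).unique (M.hasLSum_dbl_sqTerm_c_c m j i), sub_zero]
    · rw [LinearMap.sub_apply, map_sub, vac_quad_vacuum, sub_zero, h.apply_dual]
      simp [vac_sqTerm]
  rwa [sub_eq_zero.mp hD] at h

/-! ### The commutators of the weight three modes -/

theorem smul_quad (r : ℂ) (f : ℤ → ℂ) (m : ℤ) :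
    r • M.quad f m = M.quad (fun k => r * f k) m :=
  ((M.hasLSum_quad f m).smul r).unique
    ((M.hasLSum_quad _ m).congr fun _ => smul_smul _ _ _)

theorem quad_add (f g : ℤ → ℂ) (m : ℤ) :
    M.quad f m + M.quad g m = M.quad (fun k => f k + g k) m :=
  ((M.hasLSum_quad f m).add (M.hasLSum_quad g m)).unique
    ((M.hasLSum_quad _ m).congr fun _ => (add_smul _ _ _).symm)

theorem quad_sub (f g : ℤ → ℂ) (m : ℤ) :
    M.quad f m - M.quad g m = M.quad (fun k => f k - g k) m :=
  ((M.hasLSum_quad f m).sub (M.hasLSum_quad g m)).unique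
    ((M.hasLSum_quad _ m).congr fun _ => (sub_smul _ _ _).symm)

/-- The modes of the weight three field. -/
def W (m : ℤ) : Module.End ℂ F := M.quad (fun k => 1 / 2 * k * (2 * k - m)) m

theorem finsum_signedInd_W (m : ℤ) :
    ∑ᶠ k : ℤ, (1 / 2 * k * (2 * k - m) : ℂ)
        * (1 / 2 * (k - m : ℤ) * (2 * (k - m : ℤ) - (-m : ℤ))) * signedInd 0 m k
      = -(1 / 120) * m * (m ^ 2 - 1) * (m ^ 2 - 4) := by
  rw [finsum_signedInd (fun k => 1 / 4 * (4 * (k * (k + 1) * (2 * k + 1) * (3 * k ^ 2 + 3 * k - 1)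
      / 30) - 8 * m * (k ^ 2 * (k + 1) ^ 2 / 4) + 5 * m ^ 2 * (k * (k + 1) * (2 * k + 1) / 6)
      - m ^ 3 * (k * (k + 1) / 2))) _ fun k => by push_cast; ring]
  push_cast
  ring

theorem W_comm_W (m n : ℤ) :
    (2 / 3 : ℂ) • (M.W m * M.W n - M.W n * M.W m)
      = (((m : ℂ) - n) * (1 / 15 * (m + n + 3) * (m + n + 2) - 1 / 6 * (m + 2) * (n + 2)))
          • M.L (m + n)
        + (4 / 3 * ((m : ℂ) - n)) • (M.quad (sqCoeff (m + n)) (m + n)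
          - (3 / 10 * ((m + n : ℤ) + 2) * ((m + n : ℤ) + 3) : ℂ) • M.L (m + n))
        - (1 / 180 * (m : ℂ) * (m ^ 2 - 1) * (m ^ 2 - 4)) • (if m = -n then 1 else 0) := by
  rw [W, W, quad_comm_quad, smul_add, smul_quad, L, smul_quad, smul_quad, quad_sub, smul_quad,
    quad_add, sub_eq_add_neg]
  congr 1
  · congr 1
    funext k
    rw [sqCoeff]
    push_cast
    ring
  · by_cases h : m = -n
    · obtain rfl : n = -m := by omega
      rw [if_pos (by omega), if_pos h, finsum_signedInd_W, smul_smul, ← neg_smul]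
      congr 1
      ring
    · rw [if_neg (by omega), if_neg h, zero_smul, smul_zero, smul_zero, neg_zero]

end VacuumModule

open CliffordAlgebra (contractLeft)

/-- The algebra of operators on the Fock space. -/
abbrev Op : Type := Module.End ℂ FockF

/-! ### The canonical anticommutation relations -/

theorem bOp_one {n : ℤ} (h : 1 ≤ n) : bOp n (1 : FockF) = 0 := by
  rw [bOp, if_neg (by omega)]
  exact CliffordAlgebra.contractLeft_one _ _

theorem cOp_one {n : ℤ} (h : 0 ≤ n) : cOp n (1 : FockF) = 0 := by
  rw [cOp, if_pos h]
  exact CliffordAlgebra.contractLeft_one _ _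

/-- The vacuum functional. -/
def vac : FockF →ₗ[ℂ] ℂ := (algebraMapInv : FockF →ₐ[ℂ] ℂ).toLinearMap

theorem vac_one : vac 1 = 1 := map_one (algebraMapInv : FockF →ₐ[ℂ] ℂ)

theorem vac_ι_mul (v : BCSpace) (x : FockF) : vac (ι ℂ v * x) = 0 := by
  simp [vac, algebraMapInv]

theorem vac_bOp {n : ℤ} (h : n ≤ 0) (x : FockF) : vac (bOp n x) = 0 := by
  rw [bOp, if_pos h]
  exact vac_ι_mul _ _

theorem vac_cOp {n : ℤ} (h : n ≤ -1) (x : FockF) : vac (cOp n x) = 0 := by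
  rw [cOp, if_neg (by omega)]
  exact vac_ι_mul _ _

theorem mulLeft_anticomm (v w : BCSpace) :
    LinearMap.mulLeft ℂ (ι ℂ v) * LinearMap.mulLeft ℂ (ι ℂ w)
      + LinearMap.mulLeft ℂ (ι ℂ w) * LinearMap.mulLeft ℂ (ι ℂ v) = (0 : Op) := by
  refine LinearMap.ext fun x => ?_
  simp only [LinearMap.add_apply, Module.End.mul_apply, LinearMap.mulLeft_apply, ← mul_assoc,
    ← add_mul, ι_add_mul_swap, zero_mul, LinearMap.zero_apply]

theorem contractLeft_anticomm (d e : Module.Dual ℂ BCSpace) :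
    contractLeft d * contractLeft e + contractLeft e * contractLeft d = (0 : Op) := by
  refine LinearMap.ext fun x => ?_
  simp only [LinearMap.add_apply, Module.End.mul_apply, LinearMap.zero_apply]
  rw [CliffordAlgebra.contractLeft_comm]
  exact neg_add_cancel _

theorem mulLeft_contractLeft_anticomm (v : BCSpace) (d : Module.Dual ℂ BCSpace) :
    LinearMap.mulLeft ℂ (ι ℂ v) * contractLeft d + contractLeft d * LinearMap.mulLeft ℂ (ι ℂ v)
      = (d v • 1 : Op) := by
  refine LinearMap.ext fun x => ?_
  simp only [LinearMap.add_apply, Module.End.mul_apply, LinearMap.mulLeft_apply,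
    LinearMap.smul_apply, Module.End.one_apply]
  rw [show ι ℂ v = CliffordAlgebra.ι _ v from rfl, CliffordAlgebra.contractLeft_ι_mul]
  exact add_sub_cancel _ _

theorem bvDual_bv (i j : BCIndex) : bvDual i (bv j) = if j = i then 1 else 0 := by
  simp [bvDual, bv, Finsupp.single_apply]

theorem bOp_anticomm (m n : ℤ) : bOp m * bOp n + bOp n * bOp m = 0 := by
  unfold bOp
  split_ifs
  · exact mulLeft_anticomm _ _
  · rw [mulLeft_contractLeft_anticomm, bvDual_bv]
    simp
  · rw [add_comm, mulLeft_contractLeft_anticomm, bvDual_bv]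
    simp
  · exact contractLeft_anticomm _ _

theorem cOp_anticomm (m n : ℤ) : cOp m * cOp n + cOp n * cOp m = 0 := by
  unfold cOp
  split_ifs
  · exact contractLeft_anticomm _ _
  · rw [add_comm, mulLeft_contractLeft_anticomm, bvDual_bv]
    simp
  · rw [mulLeft_contractLeft_anticomm, bvDual_bv]
    simp
  · exact mulLeft_anticomm _ _

theorem bOp_cOp_anticomm (m n : ℤ) :
    bOp m * cOp n + cOp n * bOp m = if m + n = 0 then 1 else 0 := by
  unfold bOp cOp
  split_ifs with h₁ h₂ h₃ h₃ h₂ h₃ h₃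
  · rw [mulLeft_contractLeft_anticomm, bvDual_bv, if_pos (by congr 1; omega), one_smul]
  · rw [mulLeft_contractLeft_anticomm, bvDual_bv, if_neg, zero_smul]
    rw [Sum.inl.injEq]
    omega
  · omega
  · exact mulLeft_anticomm _ _
  · omega
  · exact contractLeft_anticomm _ _
  · rw [add_comm, mulLeft_contractLeft_anticomm, bvDual_bv, if_pos (by congr 1; omega), one_smul]
  · rw [add_comm, mulLeft_contractLeft_anticomm, bvDual_bv, if_neg, zero_smul]
    rw [Sum.inr.injEq]
    omega

/-! ### Parity -/

/-- The parity operator. -/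
def parity : Op := (CliffordAlgebra.involute (Q := (0 : QuadraticForm ℂ BCSpace))).toLinearMap

theorem vac_parity (x : FockF) : vac (parity x) = vac x := by
  have h : (algebraMapInv : FockF →ₐ[ℂ] ℂ).comp
      (CliffordAlgebra.involute (Q := (0 : QuadraticForm ℂ BCSpace))) = algebraMapInv := by
    ext v
    simp [algebraMapInv]
  exact DFunLike.congr_fun h x

theorem fock_induction {P : FockF → Prop} (algebraMap : ∀ r, P (algebraMap ℂ FockF r))
    (add : ∀ x y, P x → P y → P (x + y)) (ι_mul : ∀ v x, P x → P (ι ℂ v * x)) (x : FockF) : P x :=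
  CliffordAlgebra.left_induction (Q := 0) (P := P) algebraMap add (fun x v h => ι_mul v x h) x

theorem parity_mulLeft (v : BCSpace) :
    parity * LinearMap.mulLeft ℂ (ι ℂ v) = -(LinearMap.mulLeft ℂ (ι ℂ v) * parity) := by
  refine LinearMap.ext fun x => ?_
  have h := map_mul CliffordAlgebra.involute (CliffordAlgebra.ι (0 : QuadraticForm ℂ BCSpace) v) x
  rwa [CliffordAlgebra.involute_ι, neg_mul] at h

theorem parity_contractLeft (d : Module.Dual ℂ BCSpace) :
    parity * (contractLeft d : Op) = -((contractLeft d : Op) * parity) := by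
  refine LinearMap.ext fun x => ?_
  change CliffordAlgebra.involute (contractLeft d x)
    = -(contractLeft d (CliffordAlgebra.involute x))
  induction x using fock_induction with
  | algebraMap r => simp [CliffordAlgebra.contractLeft_algebraMap]
  | add x y hx hy => simp only [map_add, hx, hy, neg_add]
  | ι_mul v x hx =>
    simp only [CliffordAlgebra.contractLeft_ι_mul, map_mul, CliffordAlgebra.involute_ι, map_sub,
      map_smul, hx, neg_mul, map_neg, mul_neg, neg_neg]

theorem parity_bOp (n : ℤ) : parity * bOp n = -(bOp n * parity) := by
  unfold bOp
  split_ifs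
  · exact parity_mulLeft _
  · exact parity_contractLeft _

theorem parity_cOp (n : ℤ) : parity * cOp n = -(cOp n * parity) := by
  unfold cOp
  split_ifs
  · exact parity_contractLeft _
  · exact parity_mulLeft _

theorem parity_one : parity (1 : FockF) = 1 := map_one CliffordAlgebra.involute

/-! ### Operators which commute or anticommute with all modes -/

/-- The projection of `V` which discards the basis vectors indexed by `S`. -/
def discard (S : Finset BCIndex) : BCSpace →ₗ[ℂ] BCSpace :=
  LinearMap.id - ∑ i ∈ S, (bvDual i).smulRight (bv i)

theorem discard_apply (S : Finset BCIndex) (v : BCSpace) :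
    discard S v = v - ∑ i ∈ S, v i • bv i := by
  simp [discard, bvDual]

theorem sub_ι_mul_contractLeft (i : BCIndex) (x : FockF) :
    x - ι ℂ (bv i) * contractLeft (bvDual i) x = ExteriorAlgebra.map (discard {i}) x := by
  induction x using fock_induction with
  | algebraMap r =>
    rw [CliffordAlgebra.contractLeft_algebraMap, mul_zero, sub_zero]
    exact (AlgHom.commutes _ r).symm
  | add x y hx hy => rw [map_add, map_add, ← hx, ← hy, mul_add]; abel
  | ι_mul v x hx =>
    rw [map_mul (ExteriorAlgebra.map _), ← hx]
    erw [CliffordAlgebra.contractLeft_ι_mul]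
    change ι ℂ v * x - _ * (bvDual i v • x - ι ℂ v * _)
      = ExteriorAlgebra.map _ (ι ℂ v) * _
    rw [map_apply_ι, discard_apply, Finset.sum_singleton, map_sub, map_smul]
    have h₁ := ι_add_mul_swap (R := ℂ) v (bv i)
    have h₂ := ι_sq_zero (R := ℂ) (bv i)
    have h₃ : bvDual i v = v i := rfl
    generalize contractLeft (bvDual i) x = y
    rw [h₃, mul_sub, mul_sub, sub_mul, sub_mul, smul_mul_assoc, smul_mul_assoc, ← mul_assoc,
      ← mul_assoc, ← mul_assoc, h₂, zero_mul, smul_zero, mul_smul_comm,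
      eq_neg_of_add_eq_zero_left h₁, neg_mul]
    abel

theorem discard_insert {i : BCIndex} {S : Finset BCIndex} (h : i ∉ S) :
    discard (insert i S) = discard S ∘ₗ discard {i} := by
  refine LinearMap.ext fun v => ?_
  have hz : ∑ j ∈ S, bv i j • bv j = 0 := Finset.sum_eq_zero fun j hj => by
    rw [bv, Finsupp.single_eq_of_ne (by rintro rfl; exact h hj), zero_smul]
  simp only [LinearMap.comp_apply, discard_apply, Finset.sum_insert h, Finset.sum_singleton,
    Finsupp.sub_apply, Finsupp.smul_apply, sub_smul, Finset.sum_sub_distrib, smul_assoc,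
    ← Finset.smul_sum, hz, smul_zero]
  abel

theorem map_discard_eventually (x : FockF) :
    ∃ S : Finset BCIndex, ∀ T, S ⊆ T →
      ExteriorAlgebra.map (discard T) x = algebraMap ℂ FockF (vac x) := by
  induction x using ExteriorAlgebra.induction with
  | algebraMap r => exact ⟨∅, fun T _ => by simp [vac]⟩
  | ι v =>
    refine ⟨v.support, fun T hT => ?_⟩
    have hv : ∑ i ∈ T, v i • bv i = v := by
      conv_rhs => rw [← Finsupp.sum_single v, Finsupp.sum_of_support_subset v hT _ (by simp)]
      exact Finset.sum_congr rfl fun i _ => by simp [bv]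
    rw [map_apply_ι, discard_apply, hv, sub_self, map_zero, ← mul_one (ι ℂ v), vac_ι_mul,
      map_zero]
  | mul x y hx hy =>
    classical
    obtain ⟨S, hS⟩ := hx
    obtain ⟨S', hS'⟩ := hy
    refine ⟨S ∪ S', fun T hT => ?_⟩
    rw [map_mul, hS T (Finset.union_subset_left hT), hS' T (Finset.union_subset_right hT),
      ← map_mul]
    simp [vac]
  | add x y hx hy =>
    classical
    obtain ⟨S, hS⟩ := hx
    obtain ⟨S', hS'⟩ := hy
    refine ⟨S ∪ S', fun T hT => ?_⟩
    rw [map_add, hS T (Finset.union_subset_left hT), hS' T (Finset.union_subset_right hT),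
      ← map_add, ← map_add]

theorem eq_algebraMap_of_contractLeft_eq_zero {x : FockF}
    (h : ∀ i, contractLeft (bvDual i) x = 0) : x = algebraMap ℂ FockF (vac x) := by
  have h₁ : ∀ S : Finset BCIndex, ExteriorAlgebra.map (discard S) x = x := by
    intro S
    induction S using Finset.induction_on with
    | empty =>
      have h₀ : discard ∅ = LinearMap.id := LinearMap.ext fun v => by simp [discard_apply]
      rw [h₀, ExteriorAlgebra.map_id, AlgHom.id_apply]
    | insert i S hi ih =>
      rw [discard_insert hi, ← map_comp_map, AlgHom.comp_apply, ← sub_ι_mul_contractLeft, h i,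
        mul_zero, sub_zero, ih]
  obtain ⟨S, hS⟩ := map_discard_eventually x
  rw [← hS S subset_rfl, h₁ S]

theorem eq_zero_of_semicommute {D : Op} {s : ℂ} (hs : s ≠ 0)
    (hb : ∀ n, D * bOp n = s • (bOp n * D)) (hc : ∀ n, D * cOp n = s • (cOp n * D))
    (h₀ : vac (D 1) = 0) : D = 0 := by
  have hb₁ : ∀ n, bOp n (D 1) = s⁻¹ • D (bOp n 1) := fun n => by
    rw [← Module.End.mul_apply D, hb, LinearMap.smul_apply, inv_smul_smul₀ hs,
      Module.End.mul_apply]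
  have hc₁ : ∀ n, cOp n (D 1) = s⁻¹ • D (cOp n 1) := fun n => by
    rw [← Module.End.mul_apply D, hc, LinearMap.smul_apply, inv_smul_smul₀ hs,
      Module.End.mul_apply]
  have hD : D 1 = 0 := by
    rw [eq_algebraMap_of_contractLeft_eq_zero (x := D 1), h₀, map_zero]
    rintro (n | n)
    · have h := hc₁ n
      rw [cOp_one (by omega), map_zero, smul_zero, cOp, if_pos (by omega)] at h
      simpa using h
    · have h := hb₁ (n + 1)
      rw [bOp_one (by omega), map_zero, smul_zero, bOp, if_neg (by omega)] at h
      simpa using h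
  have hι : ∀ (v : BCSpace) (x : FockF), D (ι ℂ v * x) = s • (ι ℂ v * D x) := by
    intro v x
    induction v using Finsupp.induction_linear with
    | zero => simp
    | add v w hv hw => rw [map_add, add_mul, map_add, hv, hw, add_mul, smul_add]
    | single i r =>
      have hi : Finsupp.single i r = r • bv i := by simp [bv]
      rw [hi, map_smul, smul_mul_assoc, smul_mul_assoc, map_smul, smul_comm s r]
      congr 1
      rcases i with n | n
      · have h := LinearMap.congr_fun (hb (-n)) x
        rw [bOp, if_pos (by omega)] at h
        simpa using h
      · have h := LinearMap.congr_fun (hc (-n - 1)) x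
        rw [cOp, if_neg (by omega)] at h
        simpa using h
  refine LinearMap.ext fun x => ?_
  induction x using fock_induction with
  | algebraMap r =>
    rw [Algebra.algebraMap_eq_smul_one, map_smul, map_smul]
    exact congrArg (r • ·) hD
  | add x y hx hy => rw [map_add, hx, hy, map_add]
  | ι_mul v x hx =>
    refine (hι v x).trans ?_
    rw [hx]
    simp

/-! ### The Fock space as a vacuum module -/

theorem finite_contractLeft_bvDual (x : FockF) :
    {i | contractLeft (bvDual i) x ≠ 0}.Finite := by
  induction x using fock_induction with
  | algebraMap r => simp [CliffordAlgebra.contractLeft_algebraMap]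
  | add x y hx hy =>
    refine (hx.union hy).subset fun i hi => ?_
    by_contra hc
    simp only [Set.mem_union, Set.mem_ofPred_eq, not_or, not_not] at hc
    exact hi (by rw [map_add, hc.1, hc.2, add_zero])
  | ι_mul v x hx =>
    refine ((v.support.finite_toSet).union hx).subset fun i hi => ?_
    by_contra hc
    simp only [Set.mem_union, Set.mem_ofPred_eq, not_or, not_not, Finset.mem_coe,
      Finsupp.mem_support_iff] at hc
    have h : contractLeft (bvDual i) (ι ℂ v * x) = v i • x - ι ℂ v * contractLeft (bvDual i) x :=
      CliffordAlgebra.contractLeft_ι_mul _ _ _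
    rw [hc.1, hc.2, zero_smul, mul_zero, sub_zero] at h
    exact hi h

theorem bOp_cOp_eventually_zero (x : FockF) :
    ∃ N : ℤ, ∀ k > N, bOp k x = 0 ∧ cOp k x = 0 := by
  have h : ∀ f : ℕ → BCIndex, f.Injective →
      ∃ N : ℕ, ∀ n > N, contractLeft (bvDual (f n)) x = 0 := by
    intro f hf
    obtain ⟨N, hN⟩ := ((finite_contractLeft_bvDual x).preimage hf.injOn).bddAbove
    refine ⟨N, fun n hn => ?_⟩
    by_contra hc
    exact absurd (hN hc) (by omega)
  obtain ⟨N, hN⟩ := h Sum.inl Sum.inl_injective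
  obtain ⟨N', hN'⟩ := h Sum.inr Sum.inr_injective
  refine ⟨max N (N' + 1), fun k hk => ⟨?_, ?_⟩⟩
  · rw [bOp, if_neg (by omega)]
    exact hN' _ (by omega)
  · rw [cOp, if_pos (by omega)]
    exact hN _ (by omega)

/-- The Fock space is a vacuum module of the bc-system. -/
def fock : VacuumModule FockF where
  b := bOp
  c := cOp
  Ω := 1
  vac := vac
  parity := parity
  b_mul_b := bOp_anticomm
  c_mul_c := cOp_anticomm
  b_mul_c := bOp_cOp_anticomm
  eventually_zero := bOp_cOp_eventually_zero
  b_vacuum _ := bOp_one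
  c_vacuum _ := cOp_one
  vac_b _ := vac_bOp
  vac_c _ := vac_cOp
  vac_vacuum := vac_one
  parity_b := parity_bOp
  parity_c := parity_cOp
  vac_parity := vac_parity
  parity_vacuum := parity_one
  eq_zero _ _ := eq_zero_of_semicommute

theorem Lmode_eq (m : ℤ) (x : FockF) : Lmode m x = fock.L m x := rfl

theorem LambdaMode_eq (m : ℤ) (x : FockF) :
    LambdaMode m x = fock.quad (VacuumModule.sqCoeff m) m x
      - ((3 / 10 : ℂ) * ((m : ℂ) + 2) * ((m : ℂ) + 3)) • fock.L m x := by
  rw [← (fock.hasLSum_sqTerm m).sum_eq, LambdaMode, Lmode_eq]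
  congr 1
  refine finsum_congr fun k => ?_
  rw [VacuumModule.sqTerm]
  split_ifs <;> rfl

theorem WW_eq (m : ℤ) (x : FockF) : WW m x = ((2 / Real.sqrt 6 : ℝ) : ℂ) • fock.W m x := rfl

end BCFock

/-- The modes `L_m` and `W_m` satisfy the defining `[W_m, W_n]` relation of the `W_3`
algebra with central charge `c = −2` (for which `β = 16/(22+5c) = 4/3`). -/
theorem W_W_commutator (m n : ℤ) (x : FockF) :
    WW m (WW n x) - WW n (WW m x)
      = (((m : ℂ) - (n : ℂ)) *
            ((1 / 15 : ℂ) * ((m : ℂ) + n + 3) * ((m : ℂ) + n + 2)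
              - (1 / 6 : ℂ) * ((m : ℂ) + 2) * ((n : ℂ) + 2))) • Lmode (m + n) x
        + ((4 / 3 : ℂ) * ((m : ℂ) - (n : ℂ))) • LambdaMode (m + n) x
        - ((1 / 180 : ℂ) * (m : ℂ) * ((m : ℂ) ^ 2 - 1) * ((m : ℂ) ^ 2 - 4)) •
            (if m = -n then x else 0) := by
  have hr : ((2 / Real.sqrt 6 : ℝ) : ℂ) * ((2 / Real.sqrt 6 : ℝ) : ℂ) = 2 / 3 := by
    rw [← Complex.ofReal_mul, div_mul_div_comm, Real.mul_self_sqrt (by norm_num)]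
    norm_num
  have h := LinearMap.congr_fun (BCFock.fock.W_comm_W m n) x
  rw [BCFock.Lmode_eq, BCFock.LambdaMode_eq]
  simp only [BCFock.WW_eq, map_smul, smul_smul, hr]
  rw [← smul_sub]
  refine h.trans ?_
  have hite : (if m = -n then x else 0) = (if m = -n then (1 : Module.End ℂ FockF) else 0) x := by
    split_ifs <;> rfl
  rw [hite]
  push_cast
  rfl
end
end
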